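/- Let A and C be PI-algebras over F such that T(C) = T(A)^m. Then for all k, l >= 0, H(C; T_k; Y_l) = SUM_{j=1}^{m} binom(m,j) H(A; T_k; Y_l)^j (t_1 + ... + t_k + y_1 + ... + y_l - 1)^{j-1}. -/

import Mathlib

/-- The set of polynomial identities of `A` in the free associative algebra `F⟨x_s : s ∈ S⟩`,
i.e. the elements vanishing under every `F`-algebra homomorphism to `A`, as an `F`-subspace
(it is in fact a two-sided ideal). -/
def polyIdeal (F : Type) [Field F] (A : Type) [Ring A] [Algebra F A] (S : Type) :
    Submodule F (FreeAlgebra F S) where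
  carrier := {f | ∀ φ : FreeAlgebra F S →ₐ[F] A, φ f = 0}
  add_mem' := by
    intro a b ha hb φ
    rw [map_add, ha φ, hb φ, add_zero]
  zero_mem' := by
    intro φ
    exact map_zero φ
  smul_mem' := by
    intro r a ha φ
    rw [map_smul, ha φ, smul_zero]

/-- The span of the words (noncommutative monomials) of multidegree `m` in the free algebra. -/
noncomputable def wordSpan (F : Type) [Field F] (S : Type) [DecidableEq S] (m : S →₀ ℕ) :
    Submodule F (FreeAlgebra F S) :=
  Submodule.span F
    {x | ∃ w : List S, (∀ s : S, w.count s = m s) ∧ x = (w.map (FreeAlgebra.ι F)).prod}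

/-- The Hilbert series of the quotient of the free algebra `F⟨x_s : s ∈ S⟩` by the (multigraded)
subspace `I`: the coefficient of the monomial `m` is the dimension of the image in the quotient
of the span of the words of multidegree `m`. -/
noncomputable def gradedSeries (F : Type) [Field F] (S : Type) [DecidableEq S]
    (I : Submodule F (FreeAlgebra F S)) : MvPowerSeries S ℚ :=
  fun m =>
    (Module.finrank F (↥(wordSpan F S m) ⧸ (I.comap (wordSpan F S m).subtype)) : ℚ)

/-- The Hilbert series `H(A; t_1, …, t_d)` of the relatively free algebra
`F_d(A) = F⟨x_1,…,x_d⟩/(F⟨x_1,…,x_d⟩ ∩ T(A))`. -/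
noncomputable def hilbertSeries (F : Type) [Field F] (A : Type) [Ring A] [Algebra F A]
    (d : ℕ) : MvPowerSeries (Fin d) ℚ :=
  gradedSeries F (Fin d) (polyIdeal F A (Fin d))

/-- The infinite dimensional Grassmann (exterior) algebra over `F`, on the countable
dimensional vector space `ℕ →₀ F`. -/
abbrev Grassmann (F : Type) [Field F] : Type := ExteriorAlgebra F (ℕ →₀ F)

open scoped TensorProduct

/-- The even component of the natural `ℤ/2`-grading of the Grassmann algebra. -/
noncomputable def grassEven (F : Type) [Field F] : Submodule F (Grassmann F) :=
  ⨆ m : ℕ, (LinearMap.range (ExteriorAlgebra.ι F (M := ℕ →₀ F))) ^ (2 * m)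

/-- The odd component of the natural `ℤ/2`-grading of the Grassmann algebra. -/
noncomputable def grassOdd (F : Type) [Field F] : Submodule F (Grassmann F) :=
  ⨆ m : ℕ, (LinearMap.range (ExteriorAlgebra.ι F (M := ℕ →₀ F))) ^ (2 * m + 1)

/-- The even part `A ⊗ E⁽⁰⁾` of `A ⊗ E`. -/
noncomputable def evenPart (F : Type) [Field F] (A : Type) [Ring A] [Algebra F A] :
    Submodule F (A ⊗[F] Grassmann F) :=
  LinearMap.range (TensorProduct.map (LinearMap.id : A →ₗ[F] A) (grassEven F).subtype)

/-- The odd part `A ⊗ E⁽¹⁾` of `A ⊗ E`. -/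
noncomputable def oddPart (F : Type) [Field F] (A : Type) [Ring A] [Algebra F A] :
    Submodule F (A ⊗[F] Grassmann F) :=
  LinearMap.range (TensorProduct.map (LinearMap.id : A →ₗ[F] A) (grassOdd F).subtype)

/-- The `ℤ/2`-graded identities of the magnum `A ⊗ E` of `A` in `k` even free generators
(indexed by `Sum.inl`) and `l` odd free generators (indexed by `Sum.inr`): the elements of the
free algebra vanishing under every homomorphism sending the even generators into the even part
and the odd generators into the odd part of `A ⊗ E`. -/
def t2Ideal (F : Type) [Field F] (A : Type) [Ring A] [Algebra F A] (k l : ℕ) :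
    Submodule F (FreeAlgebra F (Fin k ⊕ Fin l)) where
  carrier := {f | ∀ φ : FreeAlgebra F (Fin k ⊕ Fin l) →ₐ[F] (A ⊗[F] Grassmann F),
      (∀ i : Fin k, φ (FreeAlgebra.ι F (Sum.inl i)) ∈ evenPart F A) →
      (∀ s : Fin l, φ (FreeAlgebra.ι F (Sum.inr s)) ∈ oddPart F A) → φ f = 0}
  add_mem' := by
    intro a b ha hb φ h1 h2
    rw [map_add, ha φ h1 h2, hb φ h1 h2, add_zero]
  zero_mem' := by
    intro φ _ _
    exact map_zero φ
  smul_mem' := by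
    intro r a ha φ h1 h2
    rw [map_smul, ha φ h1 h2, smul_zero]

/-- The double Hilbert series `H(A; t_1,…,t_k; y_1,…,y_l)` of `A`: the Hilbert series of the
magnum of `A`, where the variable indexed by `Sum.inl i` is `t_i` and the one indexed by
`Sum.inr s` is `y_s`. -/
noncomputable def doubleHilbert (F : Type) [Field F] (A : Type) [Ring A] [Algebra F A]
    (k l : ℕ) : MvPowerSeries (Fin k ⊕ Fin l) ℚ :=
  gradedSeries F (Fin k ⊕ Fin l) (t2Ideal F A k l)

namespace FreeAlgebra

open Module

section Words

variable (F : Type) [Field F] {S : Type}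

/-- The monomial of the free algebra attached to a list of letters. -/
noncomputable def word (w : List S) : FreeAlgebra F S := (w.map (ι F)).prod

@[simp] lemma word_nil : word F ([] : List S) = 1 := rfl

@[simp] lemma word_cons (s : S) (w : List S) : word F (s :: w) = ι F s * word F w := by
  simp [word]

lemma word_append (v w : List S) : word F (v ++ w) = word F v * word F w := by
  simp [word]

variable (S) in
/-- The basis of the free algebra consisting of the monomials. -/
noncomputable def wordBasis : Basis (List S) F (FreeAlgebra F S) :=
  (basisFreeMonoid F S).reindex FreeMonoid.toList

@[simp] lemma wordBasis_apply (w : List S) : wordBasis F S w = word F w := by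
  simp only [wordBasis, Basis.reindex_apply, basisFreeMonoid, Basis.map_apply,
    Finsupp.coe_basisSingleOne]
  induction w with
  | nil => exact map_one equivMonoidAlgebraFreeMonoid.symm
  | cons s w ih =>
    rw [word_cons, ← ih]
    change equivMonoidAlgebraFreeMonoid.symm (MonoidAlgebra.single
      (FreeMonoid.of s * FreeMonoid.ofList w) 1) = _ * equivMonoidAlgebraFreeMonoid.symm
        (MonoidAlgebra.single (FreeMonoid.ofList w) 1)
    rw [← one_mul (1 : F), ← MonoidAlgebra.single_mul_single, map_mul, one_mul]
    congr 1
    rw [AlgEquiv.symm_apply_eq]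
    simp [equivMonoidAlgebraFreeMonoid]

variable {F} in
lemma span_word : Submodule.span F (Set.range (word F (S := S))) = ⊤ := by
  rw [← (wordBasis F S).span_eq]
  congr 1
  ext; simp

variable {F} in
@[elab_as_elim]
lemma word_induction {p : FreeAlgebra F S → Prop} (word : ∀ w, p (word F w)) (zero : p 0)
    (add : ∀ x y, p x → p y → p (x + y)) (smul : ∀ (a : F) x, p x → p (a • x))
    (f : FreeAlgebra F S) : p f := by
  have hf : f ∈ Submodule.span F (Set.range (FreeAlgebra.word F (S := S))) := by
    rw [span_word]; trivial
  induction hf using Submodule.span_induction with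
  | mem x hx => obtain ⟨w, rfl⟩ := hx; exact word w
  | zero => exact zero
  | add x y _ _ hx hy => exact add x y hx hy
  | smul a x _ hx => exact smul a x hx

/-- The multidegree of a word. -/
noncomputable def wdeg [DecidableEq S] (w : List S) : S →₀ ℕ := Multiset.toFinsupp (w : Multiset S)

variable [DecidableEq S]

@[simp] lemma wdeg_nil : wdeg ([] : List S) = 0 := by simp [wdeg]

@[simp] lemma wdeg_cons (s : S) (w : List S) :
    wdeg (s :: w) = Finsupp.single s 1 + wdeg w := by
  rw [wdeg, wdeg, ← Multiset.cons_coe, ← Multiset.singleton_add, map_add,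
    Multiset.toFinsupp_singleton]

lemma wdeg_append (v w : List S) : wdeg (v ++ w) = wdeg v + wdeg w := by
  simp [wdeg, ← Multiset.coe_add]

lemma wdeg_apply (w : List S) (s : S) : wdeg w s = w.count s := by
  simp [wdeg]

lemma wdeg_eq_iff (w : List S) (d : S →₀ ℕ) : wdeg w = d ↔ ∀ s, w.count s = d s := by
  simp [Finsupp.ext_iff, wdeg_apply]

lemma wordSpan_eq (d : S →₀ ℕ) :
    wordSpan F S d = Submodule.span F (word F '' {w | wdeg w = d}) := by
  rw [wordSpan]
  congr 1
  ext x
  simp only [Set.mem_ofPred_eq, Set.mem_image, wdeg_eq_iff, word]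
  exact ⟨fun ⟨w, h, e⟩ => ⟨w, h, e.symm⟩, fun ⟨w, h, e⟩ => ⟨w, h, e.symm⟩⟩

variable {F} in
lemma word_mem_wordSpan (w : List S) : word F w ∈ wordSpan F S (wdeg w) := by
  rw [wordSpan_eq]
  exact Submodule.subset_span ⟨w, rfl, rfl⟩

lemma mul_mem_wordSpan {a b : S →₀ ℕ} {f g : FreeAlgebra F S}
    (hf : f ∈ wordSpan F S a) (hg : g ∈ wordSpan F S b) : f * g ∈ wordSpan F S (a + b) := by
  have h : wordSpan F S a * wordSpan F S b ≤ wordSpan F S (a + b) := by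
    conv_lhs => rw [wordSpan_eq, wordSpan_eq, Submodule.span_mul_span]
    rw [Submodule.span_le]
    rintro _ ⟨_, ⟨v, rfl, rfl⟩, _, ⟨w, rfl, rfl⟩, rfl⟩
    dsimp only
    rw [← word_append, ← wdeg_append]
    exact word_mem_wordSpan _
  exact h (Submodule.mul_mem_mul hf hg)

lemma ι_mem_wordSpan (s : S) : ι F s ∈ wordSpan F S (Finsupp.single s 1) := by
  simpa using word_mem_wordSpan (F := F) [s]

lemma finite_wdeg_eq (d : S →₀ ℕ) : {w : List S | wdeg w = d}.Finite := by
  by_cases h : ∃ w₀ : List S, wdeg w₀ = d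
  · obtain ⟨w₀, rfl⟩ := h
    refine (List.finite_toSet w₀.permutations).subset fun w hw => ?_
    rw [Set.mem_ofPred_eq, List.mem_permutations, List.perm_iff_count]
    intro s
    rw [← wdeg_apply, ← wdeg_apply, hw]
  · convert Set.finite_empty
    ext w
    simpa using fun hw => h ⟨w, hw⟩

instance finiteDimensional_wordSpan (d : S →₀ ℕ) : FiniteDimensional F (wordSpan F S d) := by
  rw [wordSpan_eq]
  exact FiniteDimensional.span_of_finite F ((finite_wdeg_eq d).image _)

/-- The projection of the free algebra onto a multihomogeneous component. -/
noncomputable def comp (d : S →₀ ℕ) : FreeAlgebra F S →ₗ[F] FreeAlgebra F S :=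
  (wordBasis F S).constr F fun w => if wdeg w = d then word F w else 0

variable {F}

lemma comp_word (d : S →₀ ℕ) (w : List S) :
    comp F d (word F w) = if wdeg w = d then word F w else 0 := by
  rw [comp, ← wordBasis_apply, Basis.constr_basis, wordBasis_apply]

lemma comp_of_mem {d e : S →₀ ℕ} {f : FreeAlgebra F S} (hf : f ∈ wordSpan F S e) :
    comp F d f = if e = d then f else 0 := by
  rw [wordSpan_eq] at hf
  induction hf using Submodule.span_induction with
  | mem x hx =>
    obtain ⟨w, rfl, rfl⟩ := hx
    exact comp_word d w
  | zero => simp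
  | add x y _ _ hx hy => rw [map_add, hx, hy]; split_ifs <;> simp
  | smul a x _ hx => rw [map_smul, hx]; split_ifs <;> simp

lemma comp_mem (d : S →₀ ℕ) (f : FreeAlgebra F S) : comp F d f ∈ wordSpan F S d := by
  induction f using word_induction with
  | word w =>
    rw [comp_word]
    split_ifs with h
    · exact h ▸ word_mem_wordSpan w
    · exact zero_mem _
  | zero => simp
  | add x y hx hy => rw [map_add]; exact add_mem hx hy
  | smul a x hx => rw [map_smul]; exact Submodule.smul_mem _ _ hx

lemma exists_sum_comp (f : FreeAlgebra F S) :
    ∃ D : Finset (S →₀ ℕ), ∀ E, D ⊆ E → ∑ d ∈ E, comp F d f = f := by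
  induction f using word_induction with
  | word w =>
    refine ⟨{wdeg w}, fun E hE => ?_⟩
    simp only [comp_word, Finset.sum_ite_eq]
    rw [if_pos (hE (Finset.mem_singleton_self _))]
  | zero => exact ⟨∅, by simp⟩
  | add x y hx hy =>
    obtain ⟨D, hD⟩ := hx
    obtain ⟨D', hD'⟩ := hy
    refine ⟨D ∪ D', fun E hE => ?_⟩
    simp only [map_add, Finset.sum_add_distrib]
    rw [hD E (Finset.union_subset_left hE), hD' E (Finset.union_subset_right hE)]
  | smul a x hx =>
    obtain ⟨D, hD⟩ := hx
    exact ⟨D, fun E hE => by simp only [map_smul, ← Finset.smul_sum, hD E hE]⟩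

/-- A subspace of the free algebra is multigraded if it contains the multihomogeneous components
of its elements. -/
def IsMultigraded (V : Submodule F (FreeAlgebra F S)) : Prop :=
  ∀ f ∈ V, ∀ d, comp F d f ∈ V

lemma IsMultigraded.le_of_forall {V U : Submodule F (FreeAlgebra F S)} (hV : IsMultigraded V)
    (h : ∀ d, ∀ f ∈ V, f ∈ wordSpan F S d → f ∈ U) : V ≤ U := by
  intro f hf
  obtain ⟨D, hD⟩ := exists_sum_comp f
  rw [← hD D subset_rfl]
  exact sum_mem fun d _ => h d _ (hV f hf d) (comp_mem d f)

lemma IsMultigraded.span {X : Set (FreeAlgebra F S)} (h : ∀ x ∈ X, ∃ d, x ∈ wordSpan F S d) :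
    IsMultigraded (Submodule.span F X) := by
  intro f hf d
  induction hf using Submodule.span_induction with
  | mem x hx =>
    obtain ⟨e, he⟩ := h x hx
    rw [comp_of_mem he]
    split_ifs
    · exact Submodule.subset_span hx
    · exact zero_mem _
  | zero => simp
  | add x y _ _ hx hy => rw [map_add]; exact add_mem hx hy
  | smul a x _ hx => rw [map_smul]; exact Submodule.smul_mem _ _ hx

lemma IsMultigraded.mul {U V : Submodule F (FreeAlgebra F S)} (hU : IsMultigraded U)
    (hV : IsMultigraded V) : IsMultigraded (U * V) := by
  intro f hf d
  induction hf using Submodule.mul_induction_on' with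
  | mem_mul_mem u hu v hv =>
    obtain ⟨D, hD⟩ := exists_sum_comp u
    obtain ⟨E, hE⟩ := exists_sum_comp v
    rw [← hD D subset_rfl, ← hE E subset_rfl, Finset.sum_mul_sum, map_sum]
    refine sum_mem fun a _ => ?_
    rw [map_sum]
    refine sum_mem fun b _ => ?_
    rw [comp_of_mem (mul_mem_wordSpan F (comp_mem a u) (comp_mem b v))]
    split_ifs
    · exact Submodule.mul_mem_mul (hU u hu a) (hV v hv b)
    · exact zero_mem _
  | add x _ y _ hx hy => rw [map_add]; exact add_mem hx hy

variable (F) in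
/-- The map removing the first letter `s` of a word, and killing the words which do not begin
with `s`. -/
noncomputable def unlead (s : S) : FreeAlgebra F S →ₗ[F] FreeAlgebra F S :=
  (wordBasis F S).constr F fun w => match w with
    | [] => 0
    | t :: w => if t = s then word F w else 0

lemma unlead_one (s : S) : unlead F s 1 = 0 := by
  rw [← word_nil F, ← wordBasis_apply, unlead, Basis.constr_basis]

lemma unlead_word_cons (s t : S) (w : List S) :
    unlead F s (word F (t :: w)) = if t = s then word F w else 0 := by
  rw [← wordBasis_apply, unlead, Basis.constr_basis]

lemma unlead_ι_mul (s t : S) (f : FreeAlgebra F S) :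
    unlead F s (ι F t * f) = if t = s then f else 0 := by
  induction f using word_induction with
  | word w => rw [← word_cons, unlead_word_cons]
  | zero => simp
  | add x y hx hy => rw [mul_add, map_add, hx, hy]; split_ifs <;> simp
  | smul a x hx => rw [mul_smul_comm, map_smul, hx]; split_ifs <;> simp

lemma unlead_mem_wordSpan (s : S) {d : S →₀ ℕ} {f : FreeAlgebra F S} (hf : f ∈ wordSpan F S d) :
    unlead F s f = 0 ∨ ∃ e, d = Finsupp.single s 1 + e ∧ unlead F s f ∈ wordSpan F S e := by
  by_cases hd : ∃ e, d = Finsupp.single s 1 + e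
  · obtain ⟨e, rfl⟩ := hd
    refine .inr ⟨e, rfl, ?_⟩
    rw [wordSpan_eq] at hf
    induction hf using Submodule.span_induction with
    | mem x hx =>
      obtain ⟨w, hw, rfl⟩ := hx
      cases w with
      | nil => rw [word_nil, unlead_one]; exact zero_mem _
      | cons t w =>
        rw [unlead_word_cons]
        split_ifs with h
        · subst h
          rw [Set.mem_ofPred_eq, wdeg_cons, add_right_inj] at hw
          exact hw ▸ word_mem_wordSpan w
        · exact zero_mem _
    | zero => simp
    | add x y _ _ hx hy => rw [map_add]; exact add_mem hx hy
    | smul a x _ hx => rw [map_smul]; exact Submodule.smul_mem _ _ hx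
  · left
    rw [wordSpan_eq] at hf
    induction hf using Submodule.span_induction with
    | mem x hx =>
      obtain ⟨w, hw, rfl⟩ := hx
      cases w with
      | nil => rw [word_nil, unlead_one]
      | cons t w =>
        rw [unlead_word_cons, if_neg]
        rintro rfl
        exact hd ⟨wdeg w, by simpa using hw.symm⟩
    | zero => simp
    | add x y _ _ hx hy => rw [map_add, hx, hy, add_zero]
    | smul a x _ hx => rw [map_smul, hx, smul_zero]

lemma algebraMap_add_sum_unlead [Fintype S] (f : FreeAlgebra F S) :
    algebraMap F _ ((wordBasis F S).repr f []) + ∑ s, ι F s * unlead F s f = f := by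
  induction f using word_induction with
  | word w =>
    rw [← wordBasis_apply, Basis.repr_self, wordBasis_apply]
    cases w with
    | nil => simp [unlead_one]
    | cons t w => simp [-word_cons, unlead_word_cons]; simp
  | zero => simp
  | add x y hx hy =>
    conv_rhs => rw [← hx, ← hy]
    simp only [map_add, Finsupp.add_apply, mul_add, Finset.sum_add_distrib]
    abel
  | smul a x hx =>
    conv_rhs => rw [← hx]
    simp only [map_smul, Finsupp.smul_apply, mul_smul_comm, ← Finset.smul_sum, smul_add,
      smul_eq_mul, map_mul]
    rw [Algebra.smul_def a (algebraMap _ _ _)]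

lemma repr_unlead (s : S) (w : List S) (f : FreeAlgebra F S) :
    (wordBasis F S).repr (unlead F s f) w = (wordBasis F S).repr f (s :: w) := by
  induction f using word_induction with
  | word v =>
    cases v with
    | nil =>
      rw [word_nil, unlead_one, ← word_nil F, ← wordBasis_apply, Basis.repr_self]
      simp
    | cons t v =>
      rw [unlead_word_cons]
      split_ifs with h
      · subst h
        rw [← wordBasis_apply, ← wordBasis_apply, Basis.repr_self, Basis.repr_self]
        simp [Finsupp.single_apply]
      · rw [← wordBasis_apply, Basis.repr_self]
        simp [h]
  | zero => simp
  | add x y hx hy => simp [hx, hy]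
  | smul a x hx => simp [hx]

variable (F S) in
/-- The span of the letters. -/
noncomputable def letters : Submodule F (FreeAlgebra F S) := Submodule.span F (Set.range (ι F))

omit [DecidableEq S] in
lemma ι_mem_letters (s : S) : ι F s ∈ letters F S := Submodule.subset_span ⟨s, rfl⟩

lemma isMultigraded_letters : IsMultigraded (letters F S) :=
  .span <| by rintro _ ⟨s, rfl⟩; exact ⟨_, ι_mem_wordSpan F s⟩

lemma unlead_mem_of_mem_letters_mul {J : Submodule F (FreeAlgebra F S)} {f : FreeAlgebra F S}
    (hf : f ∈ letters F S * J) (s : S) : unlead F s f ∈ J := by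
  have key : letters F S * J ≤ J.comap (unlead F s) := by
    rw [Submodule.mul_le]
    intro x hx g hg
    induction hx using Submodule.span_induction with
    | mem x hx =>
      obtain ⟨t, rfl⟩ := hx
      rw [Submodule.mem_comap, unlead_ι_mul]
      split_ifs
      exacts [hg, zero_mem _]
    | zero => simp
    | add x y _ _ hx hy => rw [add_mul]; exact add_mem hx hy
    | smul a x _ hx => rw [smul_mul_assoc]; exact Submodule.smul_mem _ _ hx
  exact key hf

omit [DecidableEq S] in
lemma repr_nil_of_mem_letters_mul {J : Submodule F (FreeAlgebra F S)} {f : FreeAlgebra F S}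
    (hf : f ∈ letters F S * J) : (wordBasis F S).repr f [] = 0 := by
  have key : letters F S * J ≤ LinearMap.ker ((wordBasis F S).coord []) := by
    rw [Submodule.mul_le]
    intro x hx g hg
    clear hg
    induction hx using Submodule.span_induction with
    | mem x hx =>
      obtain ⟨t, rfl⟩ := hx
      induction g using word_induction with
      | word w =>
        rw [← word_cons, ← wordBasis_apply, LinearMap.mem_ker, Basis.coord_apply,
          Basis.repr_self]
        simp
      | zero => simp
      | add x y hx hy => rw [mul_add]; exact add_mem hx hy
      | smul a x hx => rw [mul_smul_comm]; exact Submodule.smul_mem _ _ hx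
    | zero => simp
    | add x y _ _ hx hy => rw [add_mul]; exact add_mem hx hy
    | smul a x _ hx => rw [smul_mul_assoc]; exact Submodule.smul_mem _ _ hx
  exact key hf

lemma eq_sum_of_mem_letters_mul [Fintype S] {J : Submodule F (FreeAlgebra F S)}
    {f : FreeAlgebra F S} (hf : f ∈ letters F S * J) : ∑ s, ι F s * unlead F s f = f := by
  have h := algebraMap_add_sum_unlead f
  rwa [repr_nil_of_mem_letters_mul hf, map_zero, zero_add] at h

/-- A family in a left ideal `J` which is linearly independent modulo `X J`, where `X` is the span
of the letters, is linearly independent over the free algebra. -/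
lemma linearIndependent_of_letters_mul [Fintype S] {J : Submodule F (FreeAlgebra F S)}
    (hJ : ∀ f, ∀ g ∈ J, f * g ∈ J) {α : Type} {b : α → FreeAlgebra F S} (hb : ∀ i, b i ∈ J)
    (hli : LinearIndependent F fun i => (letters F S * J).mkQ (b i)) :
    LinearIndependent (FreeAlgebra F S) b := by
  have step : ∀ c : α →₀ FreeAlgebra F S, Finsupp.linearCombination _ b c = 0 →
      (∀ i, (wordBasis F S).repr (c i) [] = 0) ∧
      ∀ s, Finsupp.linearCombination _ b (c.mapRange (unlead F s) (map_zero _)) = 0 := by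
    intro c hc
    have hsplit : Finsupp.linearCombination F b
          (c.mapRange (fun f => (wordBasis F S).repr f []) (by simp)) +
        ∑ s, ι F s * Finsupp.linearCombination _ b (c.mapRange (unlead F s) (map_zero _)) = 0 := by
      refine Eq.trans ?_ hc
      simp only [Finsupp.linearCombination_apply]
      rw [Finsupp.sum_mapRange_index (by simp)]
      simp_rw [Finsupp.sum_mapRange_index (h := fun i (a : FreeAlgebra F S) => a • b i) (by simp)]
      simp only [Finsupp.sum, Finset.mul_sum]
      rw [Finset.sum_comm, ← Finset.sum_add_distrib]
      refine Finset.sum_congr rfl fun i _ => ?_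
      conv_rhs => rw [← algebraMap_add_sum_unlead (c i)]
      simp only [smul_eq_mul, Algebra.smul_def, add_mul, Finset.sum_mul, mul_assoc]
    have hmem : ∀ s, Finsupp.linearCombination (FreeAlgebra F S) b
        (c.mapRange (unlead F s) (map_zero _)) ∈ J := by
      intro s
      rw [Finsupp.linearCombination_apply]
      exact sum_mem fun i _ => hJ _ _ (hb i)
    have hc0 : c.mapRange (fun f => (wordBasis F S).repr f []) (by simp) = 0 := by
      rw [linearIndependent_iff] at hli
      apply hli
      have : Finsupp.linearCombination F (fun i => (letters F S * J).mkQ (b i)) =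
          (letters F S * J).mkQ ∘ₗ Finsupp.linearCombination F b := by
        ext; simp
      rw [this, LinearMap.comp_apply, ← LinearMap.mem_ker, Submodule.ker_mkQ,
        eq_neg_of_add_eq_zero_left hsplit]
      exact neg_mem (sum_mem fun s _ => Submodule.mul_mem_mul (ι_mem_letters s) (hmem s))
    refine ⟨fun i => by simpa using DFunLike.congr_fun hc0 i, fun s => ?_⟩
    rw [hc0, map_zero, zero_add] at hsplit
    have := congrArg (unlead F s) hsplit
    simpa [map_sum, unlead_ι_mul] using this
  rw [linearIndependent_iff]
  intro c hc
  have key : ∀ (w : List S) (c : α →₀ FreeAlgebra F S), Finsupp.linearCombination _ b c = 0 →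
      ∀ i, (wordBasis F S).repr (c i) w = 0 := by
    intro w
    induction w with
    | nil => exact fun c hc => (step c hc).1
    | cons s w ih =>
      intro c hc i
      rw [← repr_unlead]
      simpa using ih _ ((step c hc).2 s) i
  ext i : 1
  apply (wordBasis F S).repr.injective
  ext w
  simpa using key w c hc i

lemma exists_homogeneous_family {J : Submodule F (FreeAlgebra F S)} (hJ : IsMultigraded J)
    (P : Submodule F (FreeAlgebra F S)) :
    ∃ (α : Type) (b : α → FreeAlgebra F S) (deg : α → S →₀ ℕ), (∀ i, b i ∈ J) ∧
      (∀ i, b i ∈ wordSpan F S (deg i)) ∧ LinearIndependent F (fun i => P.mkQ (b i)) ∧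
      J ≤ Submodule.span F (Set.range b) ⊔ P := by
  obtain ⟨t, ht, hspan, hli⟩ := exists_linearIndependent F
    (P.mkQ '' {f | f ∈ J ∧ ∃ d, f ∈ wordSpan F S d})
  choose b hb using fun x : t => ht x.2
  choose deg hdeg using fun x : t => (hb x).1.2
  refine ⟨t, b, deg, fun i => (hb i).1.1, hdeg, ?_, ?_⟩
  · simpa only [(hb _).2] using hli
  · refine hJ.le_of_forall fun d f hf hfd => ?_
    have hmem : P.mkQ f ∈ Submodule.span F t :=
      hspan ▸ Submodule.subset_span ⟨f, ⟨hf, d, hfd⟩, rfl⟩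
    have hrange : (t : Set _) = P.mkQ '' Set.range b := by
      rw [← Set.range_comp]
      ext x
      constructor
      · exact fun hx => ⟨⟨x, hx⟩, (hb ⟨x, hx⟩).2⟩
      · rintro ⟨i, rfl⟩
        rw [Function.comp_apply, (hb i).2]
        exact i.2
    rwa [hrange, Submodule.span_image, ← Submodule.mem_comap, Submodule.comap_map_mkQ,
      sup_comm] at hmem

lemma le_span_word_mul [Fintype S] {J : Submodule F (FreeAlgebra F S)} (hJ : IsMultigraded J)
    {α : Type} {b : α → FreeAlgebra F S} {deg : α → S →₀ ℕ}
    (hdeg : ∀ i, b i ∈ wordSpan F S (deg i))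
    (hspan : J ≤ Submodule.span F (Set.range b) ⊔ letters F S * J) :
    J ≤ Submodule.span F (Set.range fun p : List S × α => word F p.1 * b p.2) := by
  set U := Submodule.span F (Set.range fun p : List S × α => word F p.1 * b p.2)
  have hbU : Submodule.span F (Set.range b) ≤ U := by
    rw [Submodule.span_le]
    rintro _ ⟨i, rfl⟩
    exact Submodule.subset_span ⟨([], i), by simp⟩
  have hιU : ∀ s, ∀ f ∈ U, ι F s * f ∈ U := by
    intro s f hf
    induction hf using Submodule.span_induction with
    | mem x hx =>
      obtain ⟨⟨w, i⟩, rfl⟩ := hx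
      exact Submodule.subset_span ⟨(s :: w, i), by simp [mul_assoc]⟩
    | zero => simp
    | add x y _ _ hx hy => rw [mul_add]; exact add_mem hx hy
    | smul a x _ hx => rw [mul_smul_comm]; exact Submodule.smul_mem _ _ hx
  have hb : IsMultigraded (Submodule.span F (Set.range b)) :=
    .span <| by rintro _ ⟨i, rfl⟩; exact ⟨_, hdeg i⟩
  have key : ∀ n, ∀ d : S →₀ ℕ, d.degree = n → ∀ f ∈ J, f ∈ wordSpan F S d → f ∈ U := by
    intro n
    induction n using Nat.strong_induction_on with
    | _ n ih =>
      rintro d rfl f hf hfd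
      obtain ⟨v, hv, p, hp, rfl⟩ := Submodule.mem_sup.1 (hspan hf)
      have hcomp := comp_of_mem (d := d) hfd
      rw [if_pos rfl, map_add] at hcomp
      rw [← hcomp]
      refine add_mem (hbU (hb v hv d)) ?_
      have hp' := (isMultigraded_letters.mul hJ) p hp d
      rw [← eq_sum_of_mem_letters_mul hp']
      refine sum_mem fun s _ => hιU s _ ?_
      rcases unlead_mem_wordSpan s (comp_mem d p) with h | ⟨e, rfl, h⟩
      · rw [h]; exact zero_mem _
      · refine ih _ ?_ e rfl _ (unlead_mem_of_mem_letters_mul hp' s) h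
        simp
  exact hJ.le_of_forall fun d f hf hfd => key _ d rfl f hf hfd

end Words

end FreeAlgebra

/-- The generating function of a family of multidegrees. -/
noncomputable def degreeSeries {S α : Type} (deg : α → S →₀ ℕ) : MvPowerSeries S ℚ :=
  fun d => (Nat.card {i // deg i = d} : ℚ)

section degreeSeries

variable {S α β : Type}

lemma coeff_degreeSeries (deg : α → S →₀ ℕ) (d : S →₀ ℕ) :
    MvPowerSeries.coeff d (degreeSeries deg) = Nat.card {i // deg i = d} := rfl

lemma degreeSeries_prod [DecidableEq S] (deg : α → S →₀ ℕ) (deg' : β → S →₀ ℕ)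
    (h : ∀ d, Finite {i // deg i = d}) (h' : ∀ d, Finite {i // deg' i = d}) :
    degreeSeries (fun p : α × β => deg p.1 + deg' p.2) =
      degreeSeries deg * degreeSeries deg' := by
  ext d
  rw [MvPowerSeries.coeff_mul, coeff_degreeSeries]
  simp only [coeff_degreeSeries]
  have e : {p : α × β // deg p.1 + deg' p.2 = d} ≃
      Σ q : Finset.HasAntidiagonal.antidiagonal d, {i // deg i = q.1.1} × {j // deg' j = q.1.2} :=
    { toFun := fun p => ⟨⟨(deg p.1.1, deg' p.1.2), by simpa using p.2⟩, ⟨p.1.1, rfl⟩, ⟨p.1.2, rfl⟩⟩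
      invFun := fun q => ⟨(q.2.1.1, q.2.2.1), by
        rw [q.2.1.2, q.2.2.2]; exact Finset.HasAntidiagonal.mem_antidiagonal.1 q.1.2⟩
      left_inv := fun p => rfl
      right_inv := by
        rintro ⟨⟨⟨a, b⟩, hab⟩, ⟨i, hi⟩, ⟨j, hj⟩⟩
        dsimp only at hi hj
        subst hi hj
        rfl }
  rw [Nat.card_congr e, Nat.card_sigma]
  simp only [Nat.card_prod]
  rw [Finset.sum_coe_sort (Finset.HasAntidiagonal.antidiagonal d)
    (fun q => Nat.card {i // deg i = q.1} * Nat.card {j // deg' j = q.2})]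
  push_cast
  rfl

open FreeAlgebra in
/-- The generating function of the words is the geometric series. -/
lemma degreeSeries_wdeg_mul [DecidableEq S] [Fintype S] :
    degreeSeries (wdeg (S := S)) * (1 - ∑ s, MvPowerSeries.X s) = 1 := by
  have hS : degreeSeries (fun s : S => Finsupp.single s 1) = ∑ s, MvPowerSeries.X s := by
    ext d
    rw [coeff_degreeSeries, map_sum]
    simp only [MvPowerSeries.coeff_X, Finset.sum_boole]
    rw [Nat.card_eq_fintype_card, Fintype.card_subtype]
    simp only [eq_comm]
  have hprod := degreeSeries_prod (fun s : S => Finsupp.single s 1) wdeg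
    (fun d => inferInstance) (fun d => (finite_wdeg_eq d).to_subtype)
  rw [mul_sub, mul_one, mul_comm _ (∑ s, _), ← hS, ← hprod, sub_eq_iff_eq_add]
  ext d
  rw [map_add, coeff_degreeSeries, coeff_degreeSeries, MvPowerSeries.coeff_one]
  have hfin' : Finite {w : List S // wdeg w = d} := (finite_wdeg_eq d).to_subtype
  have hfin : Finite {p : S × List S // Finsupp.single p.1 1 + wdeg p.2 = d} :=
    Finite.of_injective (β := {w : List S // wdeg w = d})
      (fun p => ⟨p.1.1 :: p.1.2, by rw [wdeg_cons]; exact p.2⟩) (by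
        rintro ⟨⟨s, w⟩, h⟩ ⟨⟨s', w'⟩, h'⟩ e
        simpa using e)
  have e : {w : List S // wdeg w = d} ≃
      {u : Unit // d = 0} ⊕ {p : S × List S // Finsupp.single p.1 1 + wdeg p.2 = d} :=
    { toFun := fun w => match w with
        | ⟨[], h⟩ => .inl ⟨(), by simpa using h.symm⟩
        | ⟨s :: w, h⟩ => .inr ⟨(s, w), by simpa using h⟩
      invFun := fun q => match q with
        | .inl ⟨_, h⟩ => ⟨[], by simpa using h.symm⟩
        | .inr ⟨(s, w), h⟩ => ⟨s :: w, by simpa using h⟩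
      left_inv := by rintro ⟨_ | ⟨s, w⟩, h⟩ <;> rfl
      right_inv := by rintro (⟨_, h⟩ | ⟨⟨s, w⟩, h⟩) <;> rfl }
  rw [Nat.card_congr e, Nat.card_sum]
  split_ifs with h <;> simp [h]

end degreeSeries

namespace FreeAlgebra

open Module

section IdealSeries

variable {F : Type} [Field F] {S : Type} [DecidableEq S]

/-- The Hilbert series of a subspace of the free algebra. -/
noncomputable def subspaceSeries (V : Submodule F (FreeAlgebra F S)) : MvPowerSeries S ℚ :=
  fun d => (finrank F ↥(V ⊓ wordSpan F S d) : ℚ)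

lemma finite_fiber {α : Type} {b : α → FreeAlgebra F S} {deg : α → S →₀ ℕ}
    (hdeg : ∀ i, b i ∈ wordSpan F S (deg i)) (hli : LinearIndependent F b) (d : S →₀ ℕ) :
    Finite {i // deg i = d} := by
  have h : LinearIndependent F fun i : {i // deg i = d} =>
      (⟨b i, by have := hdeg i; rwa [i.2] at this⟩ : wordSpan F S d) :=
    LinearIndependent.of_comp (wordSpan F S d).subtype
      (hli.comp (fun i : {i // deg i = d} => i.1) Subtype.val_injective)
  exact h.finite

lemma subspaceSeries_span {α : Type} {b : α → FreeAlgebra F S} {deg : α → S →₀ ℕ}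
    (hdeg : ∀ i, b i ∈ wordSpan F S (deg i)) (hli : LinearIndependent F b) :
    subspaceSeries (Submodule.span F (Set.range b)) = degreeSeries deg := by
  ext d
  change (finrank F _ : ℚ) = (Nat.card _ : ℚ)
  have : Finite {i // deg i = d} := finite_fiber hdeg hli d
  have : Fintype {i // deg i = d} := Fintype.ofFinite _
  have heq : Submodule.span F (Set.range b) ⊓ wordSpan F S d =
      Submodule.span F (Set.range fun i : {i // deg i = d} => b i) := by
    apply le_antisymm
    · rintro f ⟨hf, hfd⟩
      have hcomp := comp_of_mem (d := d) hfd
      rw [if_pos rfl] at hcomp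
      rw [← hcomp]
      clear hcomp hfd
      induction hf using Submodule.span_induction with
      | mem x hx =>
        obtain ⟨i, rfl⟩ := hx
        rw [comp_of_mem (hdeg i)]
        split_ifs with h
        · exact Submodule.subset_span ⟨⟨i, h⟩, rfl⟩
        · exact zero_mem _
      | zero => simp
      | add x y _ _ hx hy => rw [map_add]; exact add_mem hx hy
      | smul a x _ hx => rw [map_smul]; exact Submodule.smul_mem _ _ hx
    · rw [Submodule.span_le]
      rintro _ ⟨⟨i, rfl⟩, rfl⟩
      exact ⟨Submodule.subset_span ⟨i, rfl⟩, hdeg i⟩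
  have hcard := finrank_span_eq_card (hli.comp (fun i : {i // deg i = d} => i.1)
    Subtype.val_injective)
  rw [Function.comp_def] at hcard
  rw [heq, hcard, Nat.card_eq_fintype_card]

omit [DecidableEq S] in
lemma linearIndependent_word : LinearIndependent F (word F (S := S)) := by
  have h := (wordBasis F S).linearIndependent
  rwa [show ⇑(wordBasis F S) = word F from funext fun w => wordBasis_apply F w] at h

variable (F S) in
lemma subspaceSeries_top :
    subspaceSeries (⊤ : Submodule F (FreeAlgebra F S)) = degreeSeries (wdeg (S := S)) := by
  rw [← span_word]
  refine subspaceSeries_span (fun w => word_mem_wordSpan w) ?_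
  exact linearIndependent_word

lemma gradedSeries_add_subspaceSeries (I : Submodule F (FreeAlgebra F S)) :
    gradedSeries F S I + subspaceSeries I = degreeSeries (wdeg (S := S)) := by
  rw [← subspaceSeries_top F S]
  ext d
  change (finrank F _ : ℚ) + (finrank F _ : ℚ) = (finrank F _ : ℚ)
  have h := Submodule.finrank_quotient_add_finrank (I.comap (wordSpan F S d).subtype)
  have e : finrank F ↥(I ⊓ wordSpan F S d) =
      finrank F ↥(I.comap (wordSpan F S d).subtype) := by
    rw [← Submodule.finrank_map_subtype_eq, Submodule.map_comap_subtype, inf_comm]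
  rw [e, top_inf_eq, ← h]
  push_cast
  rfl

omit [DecidableEq S] in
lemma linearIndependent_mul {α β : Type} {c : β → FreeAlgebra F S} {b : α → FreeAlgebra F S}
    (hc : LinearIndependent F c) (hb : LinearIndependent (FreeAlgebra F S) b) :
    LinearIndependent F fun p : β × α => c p.1 * b p.2 :=
  linearIndependent_smul hc hb

/-- The product of a multigraded right ideal and a multigraded left ideal of the free algebra has
the Hilbert series of their tensor product over the free algebra. -/
lemma subspaceSeries_mul [Fintype S] {I J : Submodule F (FreeAlgebra F S)}
    (hI : IsMultigraded I) (hJ : IsMultigraded J) (hIr : ∀ f ∈ I, ∀ g, f * g ∈ I)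
    (hJl : ∀ f, ∀ g ∈ J, f * g ∈ J) :
    subspaceSeries (I * J) * degreeSeries (wdeg (S := S)) =
      subspaceSeries I * subspaceSeries J := by
  obtain ⟨α, b, deg, hbJ, hdeg, hli, hspan⟩ := exists_homogeneous_family hJ (letters F S * J)
  obtain ⟨β, c, deg', hcI, hdeg', hli', hspan'⟩ := exists_homogeneous_family hI ⊥
  have hfree := linearIndependent_of_letters_mul hJl hbJ hli
  have hli'' : LinearIndependent F c :=
    LinearIndependent.of_comp (Submodule.mkQ ⊥) hli'
  have hfin := finite_fiber hdeg (LinearIndependent.of_comp (letters F S * J).mkQ hli)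
  have hfin' := finite_fiber hdeg' hli''
  have hI_eq : I = Submodule.span F (Set.range c) := by
    refine le_antisymm (by simpa using hspan') ?_
    rw [Submodule.span_le]
    rintro _ ⟨i, rfl⟩
    exact hcI i
  have hJ_le := le_span_word_mul hJ hdeg hspan
  have hJ_eq : J = Submodule.span F (Set.range fun p : List S × α => word F p.1 * b p.2) := by
    refine le_antisymm hJ_le ?_
    rw [Submodule.span_le]
    rintro _ ⟨p, rfl⟩
    exact hJl _ _ (hbJ _)
  have hIJ_eq : I * J = Submodule.span F (Set.range fun p : β × α => c p.1 * b p.2) := by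
    apply le_antisymm
    · rw [Submodule.mul_le]
      intro f hf g hg
      have hg' := hJ_le hg
      clear hg
      induction hg' using Submodule.span_induction generalizing f with
      | mem x hx =>
        obtain ⟨⟨w, i⟩, rfl⟩ := hx
        have hfw := hIr f hf (word F w)
        rw [← mul_assoc]
        generalize f * word F w = g at hfw
        rw [hI_eq] at hfw
        induction hfw using Submodule.span_induction with
        | mem x hx =>
          obtain ⟨j, rfl⟩ := hx
          exact Submodule.subset_span ⟨(j, i), rfl⟩
        | zero => simp
        | add x y _ _ hx hy => rw [add_mul]; exact add_mem hx hy
        | smul a x _ hx => rw [smul_mul_assoc]; exact Submodule.smul_mem _ _ hx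
      | zero => simp
      | add x y _ _ hx hy => rw [mul_add]; exact add_mem (hx f hf) (hy f hf)
      | smul a x _ hx => rw [mul_smul_comm]; exact Submodule.smul_mem _ _ (hx f hf)
    · rw [Submodule.span_le]
      rintro _ ⟨p, rfl⟩
      exact Submodule.mul_mem_mul (hcI _) (hbJ _)
  have h1 : subspaceSeries I = degreeSeries deg' := by
    rw [hI_eq]
    exact subspaceSeries_span hdeg' hli''
  have h2 : subspaceSeries J = degreeSeries wdeg * degreeSeries deg := by
    rw [hJ_eq, ← degreeSeries_prod _ _ (fun d => (finite_wdeg_eq d).to_subtype) hfin]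
    exact subspaceSeries_span
      (fun p => mul_mem_wordSpan F (word_mem_wordSpan p.1) (hdeg p.2))
      (linearIndependent_mul linearIndependent_word hfree)
  have h3 : subspaceSeries (I * J) = degreeSeries deg' * degreeSeries deg := by
    rw [hIJ_eq, ← degreeSeries_prod _ _ hfin' hfin]
    exact subspaceSeries_span (fun p => mul_mem_wordSpan F (hdeg' p.1) (hdeg p.2))
      (linearIndependent_mul hli'' hfree)
  rw [h1, h2, h3]
  ring

lemma IsMultigraded.pow_succ {I : Submodule F (FreeAlgebra F S)} (hI : IsMultigraded I) (m : ℕ) :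
    IsMultigraded (I ^ (m + 1)) := by
  induction m with
  | zero => simpa using hI
  | succ m ih =>
    rw [_root_.pow_succ]
    exact ih.mul hI

omit [DecidableEq S] in
lemma mul_mem_pow_succ {I : Submodule F (FreeAlgebra F S)} (hIl : ∀ f, ∀ g ∈ I, f * g ∈ I)
    (m : ℕ) (f : FreeAlgebra F S) {g : FreeAlgebra F S} (hg : g ∈ I ^ (m + 1)) :
    f * g ∈ I ^ (m + 1) := by
  rw [_root_.pow_succ'] at hg ⊢
  induction hg using Submodule.mul_induction_on' with
  | mem_mul_mem u hu v hv =>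
    rw [← mul_assoc]
    exact Submodule.mul_mem_mul (hIl f u hu) hv
  | add x _ y _ hx hy => rw [mul_add]; exact add_mem hx hy

/-- The Hilbert series of the powers of a multigraded ideal of the free algebra. -/
lemma gradedSeries_pow [Fintype S] {I : Submodule F (FreeAlgebra F S)}
    (hI : IsMultigraded I) (hIr : ∀ f ∈ I, ∀ g, f * g ∈ I) (hIl : ∀ f, ∀ g ∈ I, f * g ∈ I)
    {m : ℕ} (hm : 1 ≤ m) :
    gradedSeries F S (I ^ m) = ∑ j ∈ Finset.Icc 1 m, (m.choose j : MvPowerSeries S ℚ) *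
      gradedSeries F S I ^ j * (∑ s, MvPowerSeries.X s - 1) ^ (j - 1) := by
  have hL := degreeSeries_wdeg_mul (S := S)
  set L := degreeSeries (wdeg (S := S))
  set q : MvPowerSeries S ℚ := ∑ s, MvPowerSeries.X s - 1 with hq
  have hLq : L * q = -1 := by
    rw [← hL, hq]
    ring
  have hpow : ∀ n, -q * subspaceSeries (I ^ (n + 1)) = (-q * subspaceSeries I) ^ (n + 1) := by
    intro n
    induction n with
    | zero => simp
    | succ n ih =>
      have h := subspaceSeries_mul hI (hI.pow_succ n) hIr fun f g hg => mul_mem_pow_succ hIl n f hg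
      rw [← _root_.pow_succ'] at h
      rw [_root_.pow_succ' (-q * _), ← ih]
      linear_combination (q * q) * h - (q * subspaceSeries (I ^ (n + 1 + 1))) * hLq
  have hsum : q * ∑ j ∈ Finset.Icc 1 m, (m.choose j : MvPowerSeries S ℚ) *
      gradedSeries F S I ^ j * q ^ (j - 1) = (q * gradedSeries F S I + 1) ^ m - 1 := by
    rw [add_pow, ← Finset.Ico_add_one_right_eq_Icc, Finset.sum_Ico_eq_sum_range,
      Finset.sum_range_succ', Nat.add_sub_cancel, Finset.mul_sum]
    simp only [pow_zero, one_pow, Nat.choose_zero_right, Nat.cast_one, mul_one,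
      add_sub_cancel_right]
    refine Finset.sum_congr rfl fun j _ => ?_
    rw [add_comm 1 j, Nat.add_sub_cancel, mul_pow, _root_.pow_succ q]
    ring
  have hI1 := gradedSeries_add_subspaceSeries I
  have hIm := gradedSeries_add_subspaceSeries (I ^ m)
  have hp := hpow (m - 1)
  rw [Nat.sub_add_cancel hm] at hp
  have hg : q * gradedSeries F S I + 1 = -q * subspaceSeries I := by
    linear_combination q * hI1 + hLq
  rw [hg, ← hp] at hsum
  generalize ∑ j ∈ Finset.Icc 1 m, (m.choose j : MvPowerSeries S ℚ) *
    gradedSeries F S I ^ j * q ^ (j - 1) = R at hsum ⊢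
  linear_combination hIm + L * hsum - (R + subspaceSeries (I ^ m)) * hLq

end IdealSeries

end FreeAlgebra

namespace TensorProduct

open Module

section Slices

variable {F : Type} [Field F] {M N B : Type} [AddCommGroup M] [Module F M] [AddCommGroup N]
  [Module F N] [AddCommGroup B] [Module F B]

/-- The contraction of the second tensor factor with a linear form. -/
noncomputable def slice (ℓ : B →ₗ[F] F) : M ⊗[F] B →ₗ[F] M :=
  (TensorProduct.rid F M).toLinearMap ∘ₗ ℓ.lTensor M

@[simp] lemma slice_tmul (ℓ : B →ₗ[F] F) (x : M) (b : B) : slice ℓ (x ⊗ₜ[F] b) = ℓ b • x := by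
  simp [slice]

lemma slice_rTensor (ℓ : B →ₗ[F] F) (φ : M →ₗ[F] N) (x : M ⊗[F] B) :
    slice ℓ (φ.rTensor B x) = φ (slice ℓ x) := by
  induction x with
  | zero => simp
  | tmul x b => simp
  | add x y hx hy => simp only [map_add, hx, hy]

variable (B) in
/-- The image of `V ⊗ B` in `M ⊗ B`, for a subspace `V` of `M`. -/
noncomputable def tens (V : Submodule F M) : Submodule F (M ⊗[F] B) :=
  LinearMap.range (V.subtype.rTensor B)

lemma tmul_mem_tens {V : Submodule F M} {x : M} (hx : x ∈ V) (b : B) :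
    x ⊗ₜ[F] b ∈ tens B V := ⟨⟨x, hx⟩ ⊗ₜ b, rfl⟩

lemma tens_le {V : Submodule F M} {P : Submodule F (M ⊗[F] B)}
    (h : ∀ x ∈ V, ∀ b, x ⊗ₜ[F] b ∈ P) : tens B V ≤ P := by
  rintro _ ⟨y, rfl⟩
  induction y with
  | zero => simp
  | tmul x b => exact h x x.2 b
  | add x y hx hy => rw [map_add]; exact add_mem hx hy

lemma slice_mem {V : Submodule F M} {x : M ⊗[F] B} (hx : x ∈ tens B V) (ℓ : B →ₗ[F] F) :
    slice ℓ x ∈ V := by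
  have h : tens B V ≤ V.comap (slice ℓ) := tens_le fun x hx b => by
    rw [Submodule.mem_comap, slice_tmul]
    exact V.smul_mem _ hx
  exact h hx

lemma mem_tens_of_slice {V : Submodule F M} {x : M ⊗[F] B} (h : ∀ ℓ, slice ℓ x ∈ V) :
    x ∈ tens B V := by
  classical
  let b := Basis.ofVectorSpace F B
  rw [← (equivFinsuppOfBasisRight b).symm_apply_apply x, equivFinsuppOfBasisRight_symm_apply]
  refine sum_mem fun i _ => tmul_mem_tens ?_ _
  rw [equivFinsuppOfBasisRight_apply]
  exact h (b.coord i)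

lemma tmul_ne_zero_of_ne_zero {x : M} {b : B} (hx : x ≠ 0) (hb : b ≠ 0) : x ⊗ₜ[F] b ≠ 0 := by
  obtain ⟨ℓ, hℓ⟩ := Submodule.exists_dual_map_eq_bot_of_notMem (p := (⊥ : Submodule F B))
    (x := b) (by simpa using hb) inferInstance
  intro h
  have := congrArg (slice ℓ) h
  rw [slice_tmul, map_zero, smul_eq_zero] at this
  exact this.elim hℓ.1 hx

lemma mem_of_tmul_mem_tens {V : Submodule F M} {x : M} {b : B} (hb : b ≠ 0)
    (h : x ⊗ₜ[F] b ∈ tens B V) : x ∈ V := by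
  obtain ⟨ℓ, hℓ⟩ := Submodule.exists_dual_map_eq_bot_of_notMem (p := (⊥ : Submodule F B))
    (x := b) (by simpa using hb) inferInstance
  have := slice_mem h ℓ
  rw [slice_tmul] at this
  exact (V.smul_mem_iff hℓ.1).1 this

end Slices

section Algebras

variable {F : Type} [Field F] {R B : Type} [Ring R] [Algebra F R] [Ring B] [Algebra F B]

lemma tens_mul_le (V V' : Submodule F R) : tens B V * tens B V' ≤ tens B (V * V') := by
  rw [Submodule.mul_le]
  intro x hx y hy
  have h1 : tens B V ≤ (tens B (V * V')).comap (LinearMap.mulRight F y) := by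
    refine tens_le fun v hv b => ?_
    have h2 : tens B V' ≤ (tens B (V * V')).comap (LinearMap.mulLeft F (v ⊗ₜ[F] b)) := by
      refine tens_le fun v' hv' b' => ?_
      simpa using tmul_mem_tens (Submodule.mul_mem_mul hv hv') (b * b')
    exact h2 hy
  exact h1 hx

lemma tens_pow_le (V : Submodule F R) (m : ℕ) : tens B V ^ m ≤ tens B (V ^ m) := by
  induction m with
  | zero =>
    rw [pow_zero, pow_zero, Submodule.one_le]
    exact tmul_mem_tens (Submodule.one_le.1 le_rfl) 1
  | succ m ih =>
    rw [pow_succ, pow_succ]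
    exact (mul_le_mul' ih le_rfl).trans (tens_mul_le _ _)

end Algebras

end TensorProduct

section PolyIdeal

open TensorProduct

variable {F : Type} [Field F] {A : Type} [Ring A] [Algebra F A]

/-- Over an infinite field polynomial identities are stable under extension of scalars to a
polynomial algebra. -/
lemma map_eq_zero_of_mem_polyIdeal_of_mvPolynomial [Infinite F] {S σ : Type} {g : FreeAlgebra F S}
    (hg : g ∈ polyIdeal F A S) (Φ : FreeAlgebra F S →ₐ[F] A ⊗[F] MvPolynomial σ F) :
    Φ g = 0 := by
  classical
  let b := Module.Basis.ofVectorSpace F A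
  apply (equivFinsuppOfBasisLeft b).injective
  rw [map_zero]
  ext i : 1
  rw [equivFinsuppOfBasisLeft_apply, Finsupp.zero_apply]
  apply MvPolynomial.funext
  intro x
  have h := hg ((Algebra.TensorProduct.rid F F A).toAlgHom.comp
    ((Algebra.TensorProduct.map (AlgHom.id F A) (MvPolynomial.aeval x)).comp Φ))
  simp only [AlgHom.comp_apply] at h
  generalize Φ g = y at h
  have key : MvPolynomial.eval x (TensorProduct.lid F _ ((b.coord i).rTensor _ y)) =
      b.coord i (Algebra.TensorProduct.rid F F A
        (Algebra.TensorProduct.map (AlgHom.id F A) (MvPolynomial.aeval x) y)) := by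
    clear h
    induction y with
    | zero => simp
    | tmul a p => simp [MvPolynomial.smul_eval, mul_comm, MvPolynomial.aeval_eq_eval]
    | add y z hy hz => simp only [map_add, hy, hz]
  rw [key, map_zero]
  exact (congrArg (b.coord i) h).trans (map_zero _)

/-- Over an infinite field polynomial identities are stable under extension of scalars to a
commutative algebra. -/
lemma map_eq_zero_of_mem_polyIdeal [Infinite F] {S K : Type} [CommRing K] [Algebra F K]
    {g : FreeAlgebra F S} (hg : g ∈ polyIdeal F A S) (Φ : FreeAlgebra F S →ₐ[F] A ⊗[F] K) :
    Φ g = 0 := by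
  let π : A ⊗[F] MvPolynomial K F →ₐ[F] A ⊗[F] K :=
    Algebra.TensorProduct.map (AlgHom.id F A) (MvPolynomial.aeval id)
  have hπ : Function.Surjective π := by
    intro y
    induction y with
    | zero => exact ⟨0, map_zero _⟩
    | tmul a c => exact ⟨a ⊗ₜ MvPolynomial.X c, by simp [π]⟩
    | add y z hy hz =>
      obtain ⟨y, rfl⟩ := hy
      obtain ⟨z, rfl⟩ := hz
      exact ⟨y + z, map_add _ _ _⟩
  choose p hp using fun s => hπ (Φ (FreeAlgebra.ι F s))
  have hΦ : Φ = π.comp (FreeAlgebra.lift F p) := by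
    ext s
    simp [hp]
  rw [hΦ, AlgHom.comp_apply, map_eq_zero_of_mem_polyIdeal_of_mvPolynomial hg, map_zero]

end PolyIdeal

section Grassmann

variable {F : Type} [Field F]

lemma mul_ι_of_mem_range_ι_pow {p : ℕ} {a : Grassmann F}
    (ha : a ∈ LinearMap.range (ExteriorAlgebra.ι F (M := ℕ →₀ F)) ^ p) (v : ℕ →₀ F) :
    a * ExteriorAlgebra.ι F v = (-1 : F) ^ p • (ExteriorAlgebra.ι F v * a) := by
  induction ha using Submodule.pow_induction_on_left' with
  | algebraMap r => simp [Algebra.commutes]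
  | add x y i hx hy ihx ihy => rw [add_mul, ihx, ihy, mul_add, smul_add]
  | mem_mul x hx i y hy ih =>
    obtain ⟨w, rfl⟩ := hx
    have h : ExteriorAlgebra.ι F w * ExteriorAlgebra.ι F v =
        -(ExteriorAlgebra.ι F v * ExteriorAlgebra.ι F w) :=
      eq_neg_of_add_eq_zero_left (ExteriorAlgebra.ι_add_mul_swap w v)
    rw [mul_assoc, ih, mul_smul_comm, ← mul_assoc, h, neg_mul, mul_assoc, pow_succ, mul_neg_one,
      neg_smul, smul_neg]

lemma mul_comm_of_mem_range_ι_pow {p q : ℕ} {a b : Grassmann F}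
    (ha : a ∈ LinearMap.range (ExteriorAlgebra.ι F (M := ℕ →₀ F)) ^ p)
    (hb : b ∈ LinearMap.range (ExteriorAlgebra.ι F (M := ℕ →₀ F)) ^ q) :
    a * b = (-1 : F) ^ (p * q) • (b * a) := by
  induction hb using Submodule.pow_induction_on_left' with
  | algebraMap r => simp [Algebra.commutes]
  | add x y i hx hy ihx ihy => rw [add_mul, mul_add, ihx, ihy, smul_add]
  | mem_mul x hx i y hy ih =>
    obtain ⟨v, rfl⟩ := hx
    rw [← mul_assoc, mul_ι_of_mem_range_ι_pow ha, smul_mul_assoc, mul_assoc, ih, mul_smul_comm,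
      smul_smul, ← mul_assoc, Nat.mul_succ, pow_add, mul_comm ((-1 : F) ^ p)]

lemma commute_of_mem_grassEven {a b : Grassmann F} (ha : a ∈ grassEven F)
    (hb : b ∈ grassEven F) : a * b = b * a := by
  induction ha using Submodule.iSup_induction' with
  | zero => simp
  | add x y _ _ ihx ihy => rw [add_mul, ihx, ihy, mul_add]
  | mem p x hx =>
    induction hb using Submodule.iSup_induction' with
    | zero => simp
    | add y z _ _ ihy ihz => rw [add_mul, mul_add, ihy, ihz]
    | mem q y hy =>
      rw [mul_comm_of_mem_range_ι_pow hx hy, Even.neg_one_pow, one_smul]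
      exact (even_two_mul p).mul_right _

lemma commute_of_mem_grassEven_of_mem_grassOdd {a b : Grassmann F} (ha : a ∈ grassEven F)
    (hb : b ∈ grassOdd F) : a * b = b * a := by
  induction ha using Submodule.iSup_induction' with
  | zero => simp
  | add x y _ _ ihx ihy => rw [add_mul, ihx, ihy, mul_add]
  | mem p x hx =>
    induction hb using Submodule.iSup_induction' with
    | zero => simp
    | add y z _ _ ihy ihz => rw [add_mul, mul_add, ihy, ihz]
    | mem q y hy =>
      rw [mul_comm_of_mem_range_ι_pow hx hy, Even.neg_one_pow, one_smul]
      exact (even_two_mul p).mul_right _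

lemma anticommute_of_mem_grassOdd {a b : Grassmann F} (ha : a ∈ grassOdd F)
    (hb : b ∈ grassOdd F) : a * b = -(b * a) := by
  induction ha using Submodule.iSup_induction' with
  | zero => simp
  | add x y _ _ ihx ihy => rw [add_mul, ihx, ihy, mul_add, neg_add]
  | mem p x hx =>
    induction hb using Submodule.iSup_induction' with
    | zero => simp
    | add y z _ _ ihy ihz => rw [add_mul, mul_add, ihy, ihz, neg_add]
    | mem q y hy =>
      rw [mul_comm_of_mem_range_ι_pow hx hy, Odd.neg_one_pow, neg_one_smul]
      exact (odd_two_mul_add_one p).mul (odd_two_mul_add_one q)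

lemma one_mem_grassEven : (1 : Grassmann F) ∈ grassEven F :=
  Submodule.mem_iSup_of_mem 0 (by simp)

lemma ι_mem_grassOdd (v : ℕ →₀ F) : ExteriorAlgebra.ι F v ∈ grassOdd F :=
  Submodule.mem_iSup_of_mem 0 (by simp)

/-- The products `a ⊗ b` of homogeneous elements of the same parity. -/
def sameParity (F : Type) [Field F] : Set (Grassmann F ⊗[F] Grassmann F) :=
  {x | ∃ a b, (a ∈ grassEven F ∧ b ∈ grassEven F ∨ a ∈ grassOdd F ∧ b ∈ grassOdd F) ∧
    x = a ⊗ₜ b}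

lemma commute_of_mem_sameParity : ∀ x ∈ sameParity F, ∀ y ∈ sameParity F, x * y = y * x := by
  rintro _ ⟨a, b, h | h, rfl⟩ _ ⟨c, d, h' | h', rfl⟩ <;>
    rw [Algebra.TensorProduct.tmul_mul_tmul, Algebra.TensorProduct.tmul_mul_tmul]
  · rw [commute_of_mem_grassEven h.1 h'.1, commute_of_mem_grassEven h.2 h'.2]
  · rw [commute_of_mem_grassEven_of_mem_grassOdd h.1 h'.1,
      commute_of_mem_grassEven_of_mem_grassOdd h.2 h'.2]
  · rw [commute_of_mem_grassEven_of_mem_grassOdd h'.1 h.1,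
      commute_of_mem_grassEven_of_mem_grassOdd h'.2 h.2]
  · rw [anticommute_of_mem_grassOdd h.1 h'.1, anticommute_of_mem_grassOdd h.2 h'.2,
      TensorProduct.neg_tmul, TensorProduct.tmul_neg, neg_neg]

/-- The subalgebra of `E ⊗ E` generated by the products of homogeneous elements of the same
parity. -/
noncomputable def parityAlg (F : Type) [Field F] : Subalgebra F (Grassmann F ⊗[F] Grassmann F) :=
  Algebra.adjoin F (sameParity F)

noncomputable instance : CommRing (parityAlg F) :=
  { (parityAlg F).toRing with
    mul_comm := (Algebra.isMulCommutative_adjoin F commute_of_mem_sameParity).is_comm.comm }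

lemma mem_parityAlg_of_even {a b : Grassmann F} (ha : a ∈ grassEven F) (hb : b ∈ grassEven F) :
    a ⊗ₜ[F] b ∈ parityAlg F := Algebra.subset_adjoin ⟨a, b, .inl ⟨ha, hb⟩, rfl⟩

lemma mem_parityAlg_of_odd {a b : Grassmann F} (ha : a ∈ grassOdd F) (hb : b ∈ grassOdd F) :
    a ⊗ₜ[F] b ∈ parityAlg F := Algebra.subset_adjoin ⟨a, b, .inr ⟨ha, hb⟩, rfl⟩

variable {A : Type} [Ring A] [Algebra F A]

lemma map_eq_zero_of_forall_mem_range_parityAlg [Infinite F] {S : Type} {g : FreeAlgebra F S}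
    (hg : g ∈ polyIdeal F A S) (Φ : FreeAlgebra F S →ₐ[F] A ⊗[F] (Grassmann F ⊗[F] Grassmann F))
    (hΦ : ∀ s, Φ (FreeAlgebra.ι F s) ∈
      (Algebra.TensorProduct.map (AlgHom.id F A) (parityAlg F).val).range) : Φ g = 0 := by
  choose p hp using hΦ
  have h : Φ = (Algebra.TensorProduct.map (AlgHom.id F A) (parityAlg F).val).comp
      (FreeAlgebra.lift F p) := by
    ext s
    rw [Function.comp_apply, Function.comp_apply, AlgHom.comp_apply, FreeAlgebra.lift_ι_apply]
    exact (hp s).symm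
  rw [h, AlgHom.comp_apply, map_eq_zero_of_mem_polyIdeal hg, map_zero]

end Grassmann

section Magnum

open TensorProduct

variable {F : Type} [Field F] {A : Type} [Ring A] [Algebra F A] {C : Type} [Ring C] [Algebra F C]
  {R : Type} [Ring R] [Algebra F R]

lemma map_mem_evenPart (φ : R →ₐ[F] A) {x : R ⊗[F] Grassmann F} (hx : x ∈ evenPart F R) :
    Algebra.TensorProduct.map φ (AlgHom.id F (Grassmann F)) x ∈ evenPart F A := by
  obtain ⟨y, rfl⟩ := hx
  induction y with
  | zero => simp
  | tmul a b => exact ⟨φ a ⊗ₜ b, by simp⟩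
  | add y z hy hz => rw [map_add, map_add]; exact add_mem hy hz

lemma map_mem_oddPart (φ : R →ₐ[F] A) {x : R ⊗[F] Grassmann F} (hx : x ∈ oddPart F R) :
    Algebra.TensorProduct.map φ (AlgHom.id F (Grassmann F)) x ∈ oddPart F A := by
  obtain ⟨y, rfl⟩ := hx
  induction y with
  | zero => simp
  | tmul a b => exact ⟨φ a ⊗ₜ b, by simp⟩
  | add y z hy hz => rw [map_add, map_add]; exact add_mem hy hz

lemma map_id_eq_rTensor {B : Type} [Ring B] [Algebra F B] (φ : R →ₐ[F] A) (x : R ⊗[F] B) :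
    Algebra.TensorProduct.map φ (AlgHom.id F B) x = φ.toLinearMap.rTensor B x := rfl

variable {k l : ℕ}

lemma map_mem_tens_polyIdeal {S : Type} {f : FreeAlgebra F (Fin k ⊕ Fin l)}
    (hf : f ∈ t2Ideal F A k l)
    (Ψ : FreeAlgebra F (Fin k ⊕ Fin l) →ₐ[F] FreeAlgebra F S ⊗[F] Grassmann F)
    (h0 : ∀ i, Ψ (FreeAlgebra.ι F (Sum.inl i)) ∈ evenPart F _)
    (h1 : ∀ s, Ψ (FreeAlgebra.ι F (Sum.inr s)) ∈ oddPart F _) :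
    Ψ f ∈ tens (Grassmann F) (polyIdeal F A S) := by
  refine mem_tens_of_slice fun ℓ φ => ?_
  have h := hf ((Algebra.TensorProduct.map φ (AlgHom.id F (Grassmann F))).comp Ψ)
    (fun i => map_mem_evenPart φ (h0 i)) (fun s => map_mem_oddPart φ (h1 s))
  rw [AlgHom.comp_apply, map_id_eq_rTensor] at h
  have := slice_rTensor ℓ φ.toLinearMap (Ψ f)
  rw [h, map_zero] at this
  exact this.symm

lemma exists_countable_forall_exists_rTensor_eq {M B : Type} [AddCommGroup M] [Module F M]
    [AddCommGroup B] [Module F B] (y : M ⊗[F] B) :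
    ∃ T : Set M, T.Countable ∧ ∀ (N : Type) [AddCommGroup N] [Module F N] (φ : N →ₗ[F] M),
      (∀ c ∈ T, ∃ n, φ n = c) → ∃ y', φ.rTensor B y' = y := by
  induction y with
  | zero => exact ⟨∅, Set.countable_empty, fun N _ _ φ _ => ⟨0, map_zero _⟩⟩
  | tmul c b =>
    refine ⟨{c}, Set.countable_singleton c, fun N _ _ φ h => ?_⟩
    obtain ⟨n, rfl⟩ := h c rfl
    exact ⟨n ⊗ₜ b, rfl⟩
  | add y z hy hz =>
    obtain ⟨T, hT, h⟩ := hy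
    obtain ⟨T', hT', h'⟩ := hz
    refine ⟨T ∪ T', hT.union hT', fun N _ _ φ hφ => ?_⟩
    obtain ⟨y', rfl⟩ := h N φ fun c hc => hφ c (.inl hc)
    obtain ⟨z', rfl⟩ := h' N φ fun c hc => hφ c (.inr hc)
    exact ⟨y' + z', map_add _ _ _⟩

lemma exists_lift_of_graded (φ : FreeAlgebra F (Fin k ⊕ Fin l) →ₐ[F] C ⊗[F] Grassmann F)
    (h0 : ∀ i, φ (FreeAlgebra.ι F (Sum.inl i)) ∈ evenPart F C)
    (h1 : ∀ s, φ (FreeAlgebra.ι F (Sum.inr s)) ∈ oddPart F C) :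
    ∃ (ev : FreeAlgebra F ℕ →ₐ[F] C)
      (Ψ : FreeAlgebra F (Fin k ⊕ Fin l) →ₐ[F] FreeAlgebra F ℕ ⊗[F] Grassmann F),
      (∀ i, Ψ (FreeAlgebra.ι F (Sum.inl i)) ∈ evenPart F _) ∧
      (∀ s, Ψ (FreeAlgebra.ι F (Sum.inr s)) ∈ oddPart F _) ∧
      (Algebra.TensorProduct.map ev (AlgHom.id F (Grassmann F))).comp Ψ = φ := by
  choose y hy using h0
  choose z hz using h1
  choose T hT hTy using fun i => exists_countable_forall_exists_rTensor_eq (y i)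
  choose T' hT' hTz using fun i => exists_countable_forall_exists_rTensor_eq (z i)
  obtain ⟨c, hc⟩ := (((Set.countable_iUnion hT).union (Set.countable_iUnion hT')).union
    (Set.countable_singleton (0 : C))).exists_eq_range ⟨0, .inr rfl⟩
  let ev : FreeAlgebra F ℕ →ₐ[F] C := FreeAlgebra.lift F c
  have hev : ∀ x ∈ Set.range c, ∃ n, ev.toLinearMap n = x := by
    rintro _ ⟨n, rfl⟩
    exact ⟨FreeAlgebra.ι F n, by simp [ev]⟩
  choose y' hy' using fun i => hTy i _ ev.toLinearMap fun x hx =>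
    hev x (hc ▸ .inl (.inl (Set.mem_iUnion_of_mem i hx)))
  choose z' hz' using fun i => hTz i _ ev.toLinearMap fun x hx =>
    hev x (hc ▸ .inl (.inr (Set.mem_iUnion_of_mem i hx)))
  have key : ∀ (P : Submodule F (Grassmann F)) (x : FreeAlgebra F ℕ ⊗[F] P),
      Algebra.TensorProduct.map ev (AlgHom.id F (Grassmann F))
        (TensorProduct.map LinearMap.id P.subtype x) =
      TensorProduct.map LinearMap.id P.subtype (ev.toLinearMap.rTensor P x) := by
    intro P x
    induction x with
    | zero => simp
    | tmul a b => simp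
    | add x y hx hy => simp only [map_add, hx, hy]
  refine ⟨ev, FreeAlgebra.lift F (Sum.elim
    (fun i => TensorProduct.map LinearMap.id (grassEven F).subtype (y' i))
    (fun s => TensorProduct.map LinearMap.id (grassOdd F).subtype (z' s))), ?_, ?_, ?_⟩
  · intro i
    rw [FreeAlgebra.lift_ι_apply]
    exact ⟨y' i, rfl⟩
  · intro s
    rw [FreeAlgebra.lift_ι_apply]
    exact ⟨z' s, rfl⟩
  · ext s
    rw [Function.comp_apply, Function.comp_apply, AlgHom.comp_apply, FreeAlgebra.lift_ι_apply]
    rcases s with i | s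
    · rw [Sum.elim_inl, key, hy', hy]
    · rw [Sum.elim_inr, key, hz', hz]

lemma pow_t2Ideal_le {m : ℕ} (h : polyIdeal F C ℕ = polyIdeal F A ℕ ^ m) :
    t2Ideal F A k l ^ m ≤ t2Ideal F C k l := by
  intro f hf φ h0 h1
  obtain ⟨ev, Ψ, hΨ0, hΨ1, rfl⟩ := exists_lift_of_graded φ h0 h1
  have h2 : (t2Ideal F A k l).map Ψ.toLinearMap ≤ tens (Grassmann F) (polyIdeal F A ℕ) := by
    rintro _ ⟨g, hg, rfl⟩
    exact map_mem_tens_polyIdeal hg Ψ hΨ0 hΨ1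
  have h3 : Ψ f ∈ tens (Grassmann F) (polyIdeal F C ℕ) := by
    rw [h]
    refine tens_pow_le _ _ (pow_le_pow_left' h2 m ?_)
    rw [← Submodule.map_pow]
    exact ⟨f, hf, rfl⟩
  have h4 : tens (Grassmann F) (polyIdeal F C ℕ) ≤ LinearMap.ker
      (Algebra.TensorProduct.map ev (AlgHom.id F (Grassmann F))).toLinearMap := by
    refine tens_le fun x hx b => ?_
    simp [hx ev]
  exact h4 h3

lemma assoc_tmul_mem_range {P : Submodule F (Grassmann F)} {e : Grassmann F}
    (hP : ∀ b ∈ P, b ⊗ₜ[F] e ∈ parityAlg F) {x : A ⊗[F] Grassmann F}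
    (hx : x ∈ LinearMap.range (TensorProduct.map (LinearMap.id : A →ₗ[F] A) P.subtype)) :
    Algebra.TensorProduct.assoc F F F A (Grassmann F) (Grassmann F) (x ⊗ₜ e) ∈
      (Algebra.TensorProduct.map (AlgHom.id F A) (parityAlg F).val).range := by
  obtain ⟨y, rfl⟩ := hx
  induction y with
  | zero => simp
  | tmul a b =>
    exact ⟨a ⊗ₜ ⟨b ⊗ₜ e, hP b b.2⟩, by simp⟩
  | add y z hy hz =>
    rw [map_add, add_tmul, map_add]
    exact add_mem hy hz

lemma map_mem_tens_t2Ideal [Infinite F] {S : Type} {g : FreeAlgebra F S}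
    (hg : g ∈ polyIdeal F A S)
    (Θ : FreeAlgebra F S →ₐ[F] FreeAlgebra F (Fin k ⊕ Fin l) ⊗[F] Grassmann F)
    (hΘ : ∀ n, Θ (FreeAlgebra.ι F n) = 0 ∨
      (∃ i, Θ (FreeAlgebra.ι F n) = FreeAlgebra.ι F (Sum.inl i) ⊗ₜ 1) ∨
      ∃ s, ∃ e ∈ grassOdd F, Θ (FreeAlgebra.ι F n) = FreeAlgebra.ι F (Sum.inr s) ⊗ₜ e) :
    Θ g ∈ tens (Grassmann F) (t2Ideal F A k l) := by
  refine mem_tens_of_slice fun ℓ φ h0 h1 => ?_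
  let Φ := (Algebra.TensorProduct.assoc F F F A (Grassmann F) (Grassmann F)).toAlgHom.comp
    ((Algebra.TensorProduct.map φ (AlgHom.id F (Grassmann F))).comp Θ)
  have h : Φ g = 0 := by
    refine map_eq_zero_of_forall_mem_range_parityAlg hg Φ fun n => ?_
    simp only [Φ, AlgHom.comp_apply]
    rcases hΘ n with h | ⟨i, h⟩ | ⟨s, e, he, h⟩
    · rw [h, map_zero, map_zero]
      exact zero_mem _
    · rw [h, Algebra.TensorProduct.map_tmul]
      exact assoc_tmul_mem_range (fun b hb => mem_parityAlg_of_even hb one_mem_grassEven) (h0 i)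
    · rw [h, Algebra.TensorProduct.map_tmul]
      exact assoc_tmul_mem_range (fun b hb => mem_parityAlg_of_odd hb he) (h1 s)
  have h' : Algebra.TensorProduct.map φ (AlgHom.id F (Grassmann F)) (Θ g) = 0 :=
    (Algebra.TensorProduct.assoc F F F A (Grassmann F) (Grassmann F)).injective
      (h.trans (map_zero _).symm)
  rw [map_id_eq_rTensor] at h'
  have := slice_rTensor ℓ φ.toLinearMap (Θ g)
  rw [h', map_zero] at this
  exact this.symm

end Magnum

section NilpotentSums

variable {K : Type} [CommRing K]

lemma add_pow_succ_of_sq_eq_zero {a : K} (ha : a ^ 2 = 0) (b : K) (n : ℕ) :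
    (a + b) ^ (n + 1) = b ^ (n + 1) + (n + 1 : ℕ) * (a * b ^ n) := by
  induction n with
  | zero => simp [add_comm]
  | succ n ih =>
    rw [pow_succ, ih]
    push_cast
    linear_combination ((n + 1) * b ^ n) * ha

lemma sum_pow_card_of_sq_eq_zero {α : Type} [DecidableEq α] (T : Finset α) {v : α → K}
    (hv : ∀ a, v a ^ 2 = 0) :
    (∑ a ∈ T, v a) ^ T.card = T.card.factorial * ∏ a ∈ T, v a ∧
      (∑ a ∈ T, v a) ^ (T.card + 1) = 0 := by
  induction T using Finset.induction_on with
  | empty => simp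
  | insert a T ha ih =>
    rw [Finset.sum_insert ha, Finset.prod_insert ha, Finset.card_insert_of_notMem ha,
      add_pow_succ_of_sq_eq_zero (hv a), add_pow_succ_of_sq_eq_zero (hv a), ih.1, ih.2,
      pow_succ, ih.2, Nat.factorial_succ]
    constructor
    · push_cast
      ring
    · ring

end NilpotentSums

section Grassmann

variable {F : Type} [Field F]

/-- The generator `e_n` of the Grassmann algebra. -/
noncomputable def grassGen (F : Type) [Field F] (n : ℕ) : Grassmann F :=
  ExteriorAlgebra.ι F (Finsupp.single n 1)

lemma grassGen_mem_grassOdd (n : ℕ) : grassGen F n ∈ grassOdd F := ι_mem_grassOdd _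

lemma contractLeft_prod_grassGen {a : ℕ} {L : List ℕ} (ha : a ∉ L) :
    CliffordAlgebra.contractLeft (Q := (0 : QuadraticForm F (ℕ →₀ F))) (Finsupp.lapply a)
      (L.map (grassGen F)).prod = 0 := by
  induction L with
  | nil => simp
  | cons b L ih =>
    rw [List.mem_cons, not_or] at ha
    rw [List.map_cons, List.prod_cons]
    have h := CliffordAlgebra.contractLeft_ι_mul (Q := (0 : QuadraticForm F (ℕ →₀ F)))
      (Finsupp.lapply a) (Finsupp.single b 1) (L.map (grassGen F)).prod
    rw [ih ha.2, mul_zero, sub_zero, Finsupp.lapply_apply,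
      Finsupp.single_eq_of_ne ha.1, zero_smul] at h
    exact h

lemma prod_grassGen_ne_zero {L : List ℕ} (hL : L.Nodup) : (L.map (grassGen F)).prod ≠ 0 := by
  induction L with
  | nil => simp
  | cons a L ih =>
    rw [List.nodup_cons] at hL
    rw [List.map_cons, List.prod_cons]
    have h := CliffordAlgebra.contractLeft_ι_mul (Q := (0 : QuadraticForm F (ℕ →₀ F)))
      (Finsupp.lapply a) (Finsupp.single a 1) (L.map (grassGen F)).prod
    rw [contractLeft_prod_grassGen hL.1, mul_zero, sub_zero, Finsupp.lapply_apply,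
      Finsupp.single_eq_same, one_smul] at h
    intro h0
    apply ih hL.2
    rw [← h]
    exact (congrArg _ h0).trans (map_zero _)

lemma grassGen_mul_self (n : ℕ) : grassGen F n * grassGen F n = 0 :=
  ExteriorAlgebra.ι_sq_zero _

/-- The element `e_n ⊗ e_n`. -/
noncomputable def grassGenSq (F : Type) [Field F] (n : ℕ) : parityAlg F :=
  ⟨grassGen F n ⊗ₜ grassGen F n,
    mem_parityAlg_of_odd (grassGen_mem_grassOdd n) (grassGen_mem_grassOdd n)⟩

lemma grassGenSq_sq (n : ℕ) : grassGenSq F n ^ 2 = 0 := by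
  apply Subtype.ext
  change (grassGen F n ⊗ₜ[F] grassGen F n) ^ 2 = 0
  rw [sq, Algebra.TensorProduct.tmul_mul_tmul, grassGen_mul_self, TensorProduct.zero_tmul]

lemma prod_grassGenSq_ne_zero {α : Type} (T : Finset α) {enc : α → ℕ}
    (henc : Function.Injective enc) : ∏ a ∈ T, grassGenSq F (enc a) ≠ 0 := by
  have h : ∀ L : List ℕ, ((parityAlg F).val (L.map (grassGenSq F)).prod) =
      (L.map (grassGen F)).prod ⊗ₜ (L.map (grassGen F)).prod := by
    intro L
    induction L with
    | nil => rfl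
    | cons a L ih =>
      rw [List.map_cons, List.prod_cons, map_mul, ih, List.map_cons, List.prod_cons,
        ← Algebra.TensorProduct.tmul_mul_tmul]
      rfl
  have hT := prod_grassGen_ne_zero (F := F) (T.nodup_toList.map henc)
  intro h0
  apply TensorProduct.tmul_ne_zero_of_ne_zero (F := F) hT hT
  rw [← h, List.map_map, Finset.prod_map_toList]
  exact (congrArg (parityAlg F).val h0).trans (map_zero _)

/-- The even or odd element by which the degree in the variable `s` is detected. -/
noncomputable def degreeWitness (F : Type) [Field F] {k l : ℕ} (d : Fin k ⊕ Fin l →₀ ℕ) :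
    Fin k ⊕ Fin l → parityAlg F
  | Sum.inl _ => 1
  | Sum.inr s => ∑ j ∈ Finset.range (d (Sum.inr s)),
      grassGenSq F (Encodable.encode (Sum.inr ⟨s, j⟩ : Fin k ⊕ (Σ _ : Fin l, ℕ)))

lemma prod_degreeWitness_ne_zero [CharZero F] {k l : ℕ} (d : Fin k ⊕ Fin l →₀ ℕ) :
    ∏ s, degreeWitness F d s ^ d s ≠ 0 := by
  rw [Fintype.prod_sum_type]
  simp only [degreeWitness, one_pow, Finset.prod_const_one, one_mul]
  have h : ∀ s : Fin l, (∑ j ∈ Finset.range (d (Sum.inr s)),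
      grassGenSq F (Encodable.encode (Sum.inr ⟨s, j⟩ : Fin k ⊕ (Σ _ : Fin l, ℕ)))) ^
        d (Sum.inr s) = (d (Sum.inr s)).factorial * ∏ j ∈ Finset.range (d (Sum.inr s)),
      grassGenSq F (Encodable.encode (Sum.inr ⟨s, j⟩ : Fin k ⊕ (Σ _ : Fin l, ℕ))) := by
    intro s
    have := (sum_pow_card_of_sq_eq_zero (Finset.range (d (Sum.inr s)))
      (v := fun j => grassGenSq F
        (Encodable.encode (Sum.inr ⟨s, j⟩ : Fin k ⊕ (Σ _ : Fin l, ℕ))))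
      fun j => grassGenSq_sq _).1
    rwa [Finset.card_range] at this
  simp only [h]
  rw [Finset.prod_mul_distrib, ← Nat.cast_prod, ← nsmul_eq_mul, ← Nat.cast_smul_eq_nsmul F]
  refine smul_ne_zero ?_ ?_
  · exact Nat.cast_ne_zero.2 (Finset.prod_ne_zero_iff.2 fun s _ => Nat.factorial_ne_zero _)
  · have := prod_grassGenSq_ne_zero (F := F)
      (Finset.univ.sigma fun s : Fin l => Finset.range (d (Sum.inr s)))
      (enc := fun p => Encodable.encode (Sum.inr p : Fin k ⊕ (Σ _ : Fin l, ℕ)))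
      (Encodable.encode_injective.comp Sum.inr_injective)
    rwa [Finset.prod_sigma] at this

end Grassmann

namespace FreeAlgebra

variable {F : Type} [Field F] {S : Type} [DecidableEq S] [Fintype S]

lemma prod_map_eq_prod_pow_wdeg {K : Type} [CommMonoid K] (u : S → K) (w : List S) :
    (w.map u).prod = ∏ s, u s ^ wdeg w s := by
  rw [Finset.prod_list_map_count]
  refine (Finset.prod_subset (Finset.subset_univ _) fun s _ hs => ?_).trans
    (Finset.prod_congr rfl fun s _ => by rw [wdeg_apply])
  rw [List.count_eq_zero_of_not_mem (by simpa using hs), pow_zero]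

lemma lift_smul_ι_of_mem (c : S → F) {d : S →₀ ℕ} {f : FreeAlgebra F S}
    (hf : f ∈ wordSpan F S d) :
    lift F (fun s => c s • ι F s) f = (∏ s, c s ^ d s) • f := by
  rw [wordSpan_eq] at hf
  induction hf using Submodule.span_induction with
  | mem x hx =>
    obtain ⟨w, rfl, rfl⟩ := hx
    rw [← prod_map_eq_prod_pow_wdeg]
    induction w with
    | nil => simp
    | cons s w ih =>
      rw [word_cons, map_mul, ih, lift_ι_apply, List.map_cons, List.prod_cons,
        smul_mul_smul_comm]
  | zero => simp
  | add x y _ _ hx hy => rw [map_add, hx, hy, smul_add]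
  | smul a x _ hx => rw [map_smul, hx, smul_comm]

/-- Over an infinite field, a subspace stable under all rescalings of the variables is
multigraded. -/
lemma IsMultigraded.of_forall_lift_smul_ι [Infinite F] {I : Submodule F (FreeAlgebra F S)}
    (hI : ∀ c : S → F, ∀ f ∈ I, lift F (fun s => c s • ι F s) f ∈ I) : IsMultigraded I := by
  intro f hf d
  by_contra hd
  obtain ⟨ℓ, hℓd, hℓ⟩ := Submodule.exists_dual_map_eq_bot_of_notMem hd inferInstance
  obtain ⟨D, hD⟩ := exists_sum_comp f
  let p : MvPolynomial S F := ∑ e ∈ insert d D, MvPolynomial.monomial e (ℓ (comp F e f))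
  have hp : p = 0 := by
    apply MvPolynomial.funext
    intro c
    have h : ℓ (lift F (fun s => c s • ι F s) f) = 0 := by
      have : ℓ (lift F (fun s => c s • ι F s) f) ∈ I.map ℓ := ⟨_, hI c f hf, rfl⟩
      rwa [hℓ, Submodule.mem_bot] at this
    rw [map_zero, ← h]
    conv_rhs => rw [← hD _ (Finset.subset_insert d D)]
    simp only [p, map_sum, lift_smul_ι_of_mem c (comp_mem _ f), MvPolynomial.eval_monomial,
      map_smul, smul_eq_mul]
    refine Finset.sum_congr rfl fun e _ => ?_
    rw [Finsupp.prod_fintype _ _ fun _ => pow_zero _, mul_comm]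
  apply hℓd
  have := congrArg (MvPolynomial.coeff d) hp
  simpa [p, MvPolynomial.coeff_sum, MvPolynomial.coeff_monomial] using this

end FreeAlgebra

section Magnum

open TensorProduct FreeAlgebra

variable {F : Type} [Field F] {A : Type} [Ring A] [Algebra F A] {C : Type} [Ring C] [Algebra F C]
  {k l : ℕ}

lemma map_eq_tmul_prod_degreeWitness
    (Ξ : FreeAlgebra F (Fin k ⊕ Fin l) →ₐ[F]
      FreeAlgebra F (Fin k ⊕ Fin l) ⊗[F] (Grassmann F ⊗[F] Grassmann F))
    (u : Fin k ⊕ Fin l → parityAlg F)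
    (hΞ : ∀ s, Ξ (ι F s) = ι F s ⊗ₜ (parityAlg F).val (u s))
    {d : Fin k ⊕ Fin l →₀ ℕ} {f : FreeAlgebra F (Fin k ⊕ Fin l)} (hf : f ∈ wordSpan F _ d) :
    Ξ f = f ⊗ₜ (parityAlg F).val (∏ s, u s ^ d s) := by
  rw [wordSpan_eq] at hf
  induction hf using Submodule.span_induction with
  | mem x hx =>
    obtain ⟨w, rfl, rfl⟩ := hx
    rw [← prod_map_eq_prod_pow_wdeg]
    induction w with
    | nil => rw [word_nil, map_one, Algebra.TensorProduct.one_def]; rfl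
    | cons s w ih =>
      rw [word_cons, map_mul, ih, hΞ, List.map_cons, List.prod_cons,
        Algebra.TensorProduct.tmul_mul_tmul]
      rfl
  | zero => simp
  | add x y _ _ hx hy => rw [map_add, hx, hy, add_tmul]
  | smul a x _ hx => rw [map_smul, hx, smul_tmul']

lemma isMultigraded_t2Ideal [Infinite F] : IsMultigraded (t2Ideal F A k l) := by
  refine .of_forall_lift_smul_ι fun c f hf φ h0 h1 => ?_
  refine hf (φ.comp (lift F fun s => c s • ι F s)) (fun i => ?_) fun s => ?_
  · rw [AlgHom.comp_apply, lift_ι_apply, map_smul]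
    exact Submodule.smul_mem _ _ (h0 i)
  · rw [AlgHom.comp_apply, lift_ι_apply, map_smul]
    exact Submodule.smul_mem _ _ (h1 s)

lemma tmul_one_mem_evenPart {R : Type} [Ring R] [Algebra F R] (x : R) :
    x ⊗ₜ 1 ∈ evenPart F R := ⟨x ⊗ₜ ⟨1, one_mem_grassEven⟩, rfl⟩

lemma tmul_grassGen_mem_oddPart {R : Type} [Ring R] [Algebra F R] (x : R) (n : ℕ) :
    x ⊗ₜ grassGen F n ∈ oddPart F R := ⟨x ⊗ₜ ⟨grassGen F n, grassGen_mem_grassOdd n⟩, rfl⟩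

/-- The generic elements of multidegree `d`: a substitution of elements of `F⟨X_0, X_1, …⟩ ⊗ E`
for the variables which linearizes in the odd ones. -/
noncomputable def genericSubst (F : Type) [Field F] (d : Fin k ⊕ Fin l →₀ ℕ) :
    FreeAlgebra F (Fin k ⊕ Fin l) →ₐ[F] FreeAlgebra F ℕ ⊗[F] Grassmann F :=
  lift F fun
    | Sum.inl i =>
      ι F (Encodable.encode (Sum.inl i : Fin k ⊕ (Σ _ : Fin l, ℕ))) ⊗ₜ 1
    | Sum.inr s => ∑ j ∈ Finset.range (d (Sum.inr s)),
      ι F (Encodable.encode (Sum.inr ⟨s, j⟩ : Fin k ⊕ (Σ _ : Fin l, ℕ))) ⊗ₜ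
        grassGen F (Encodable.encode (Sum.inr ⟨s, j⟩ : Fin k ⊕ (Σ _ : Fin l, ℕ)))

variable (F k l) in
/-- The substitution which restores the variables replaced by `genericSubst`. -/
noncomputable def restitution :
    FreeAlgebra F ℕ →ₐ[F] FreeAlgebra F (Fin k ⊕ Fin l) ⊗[F] Grassmann F :=
  lift F fun n => match (Encodable.decode n : Option (Fin k ⊕ (Σ _ : Fin l, ℕ))) with
    | none => 0
    | some (Sum.inl i) => ι F (Sum.inl i) ⊗ₜ 1
    | some (Sum.inr p) => ι F (Sum.inr p.1) ⊗ₜ grassGen F n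

lemma restitution_ι (n : ℕ) : restitution F k l (ι F n) = 0 ∨
    (∃ i, restitution F k l (ι F n) = ι F (Sum.inl i) ⊗ₜ 1) ∨
    ∃ s, ∃ e ∈ grassOdd F, restitution F k l (ι F n) = ι F (Sum.inr s) ⊗ₜ e := by
  rw [restitution, lift_ι_apply]
  rcases (Encodable.decode n : Option (Fin k ⊕ (Σ _ : Fin l, ℕ))) with _ | i | p
  · exact .inl rfl
  · exact .inr (.inl ⟨i, rfl⟩)
  · exact .inr (.inr ⟨p.1, _, grassGen_mem_grassOdd n, rfl⟩)

lemma restitution_ι_encode_inl (i : Fin k) :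
    restitution F k l (ι F (Encodable.encode (Sum.inl i : Fin k ⊕ (Σ _ : Fin l, ℕ)))) =
      ι F (Sum.inl i) ⊗ₜ 1 := by
  rw [restitution, lift_ι_apply, Encodable.encodek]

lemma restitution_ι_encode_inr (p : Σ _ : Fin l, ℕ) :
    restitution F k l (ι F (Encodable.encode (Sum.inr p : Fin k ⊕ (Σ _ : Fin l, ℕ)))) =
      ι F (Sum.inr p.1) ⊗ₜ
        grassGen F (Encodable.encode (Sum.inr p : Fin k ⊕ (Σ _ : Fin l, ℕ))) := by
  rw [restitution, lift_ι_apply, Encodable.encodek]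

lemma genericSubst_mem_tens {f : FreeAlgebra F (Fin k ⊕ Fin l)} (hf : f ∈ t2Ideal F C k l)
    (d : Fin k ⊕ Fin l →₀ ℕ) :
    genericSubst F d f ∈ tens (Grassmann F) (polyIdeal F C ℕ) := by
  refine map_mem_tens_polyIdeal hf _ (fun i => ?_) fun s => ?_
  · rw [genericSubst, lift_ι_apply]
    exact tmul_one_mem_evenPart _
  · rw [genericSubst, lift_ι_apply]
    exact sum_mem fun j _ => tmul_grassGen_mem_oddPart _ _

lemma restitution_mem_tens [Infinite F] (m : ℕ) {g : FreeAlgebra F ℕ}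
    (hg : g ∈ polyIdeal F A ℕ ^ m) :
    restitution F k l g ∈ tens (Grassmann F) (t2Ideal F A k l ^ m) := by
  have h : (polyIdeal F A ℕ).map (restitution F k l).toLinearMap ≤
      tens (Grassmann F) (t2Ideal F A k l) := by
    rintro _ ⟨g, hg, rfl⟩
    exact map_mem_tens_t2Ideal hg _ restitution_ι
  refine tens_pow_le _ _ (pow_le_pow_left' h m ?_)
  rw [← Submodule.map_pow]
  exact ⟨g, hg, rfl⟩

lemma mem_pow_t2Ideal_of_mem_wordSpan [CharZero F] {m : ℕ}
    (h : polyIdeal F C ℕ = polyIdeal F A ℕ ^ m) {d : Fin k ⊕ Fin l →₀ ℕ}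
    {f : FreeAlgebra F (Fin k ⊕ Fin l)} (hf : f ∈ t2Ideal F C k l) (hd : f ∈ wordSpan F _ d) :
    f ∈ t2Ideal F A k l ^ m := by
  let assoc := Algebra.TensorProduct.assoc F F F (FreeAlgebra F (Fin k ⊕ Fin l)) (Grassmann F)
    (Grassmann F)
  let Λ := assoc.toAlgHom.comp
    (Algebra.TensorProduct.map (restitution F k l) (AlgHom.id F (Grassmann F)))
  have hΞ := map_eq_tmul_prod_degreeWitness (Λ.comp (genericSubst F d)) (degreeWitness F d)
    (by
      rintro (i | s)
      · simp only [AlgHom.comp_apply, genericSubst, lift_ι_apply, Λ,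
          Algebra.TensorProduct.map_tmul, restitution_ι_encode_inl]
        rfl
      · simp only [AlgHom.comp_apply, genericSubst, lift_ι_apply, Λ, map_sum,
          Algebra.TensorProduct.map_tmul, restitution_ι_encode_inr, degreeWitness, tmul_sum]
        rfl) hd
  have hΛ : tens (Grassmann F) (polyIdeal F C ℕ) ≤
      (tens (Grassmann F ⊗[F] Grassmann F) (t2Ideal F A k l ^ m)).comap Λ.toLinearMap := by
    refine tens_le fun x hx b => ?_
    rw [h] at hx
    have h1 : tens (Grassmann F) (t2Ideal F A k l ^ m) ≤
        (tens (Grassmann F ⊗[F] Grassmann F) (t2Ideal F A k l ^ m)).comap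
          (assoc.toLinearMap ∘ₗ (TensorProduct.mk F _ (Grassmann F)).flip b) :=
      tens_le fun y hy a => tmul_mem_tens hy (a ⊗ₜ b)
    exact h1 (restitution_mem_tens m hx)
  have hmem : Λ.comp (genericSubst F d) f ∈
      tens (Grassmann F ⊗[F] Grassmann F) (t2Ideal F A k l ^ m) := hΛ (genericSubst_mem_tens hf d)
  rw [hΞ] at hmem
  refine mem_of_tmul_mem_tens (fun h0 => prod_degreeWitness_ne_zero (F := F) d ?_) hmem
  exact Subtype.ext h0

lemma t2Ideal_eq_pow [CharZero F] {m : ℕ} (h : polyIdeal F C ℕ = polyIdeal F A ℕ ^ m) :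
    t2Ideal F C k l = t2Ideal F A k l ^ m :=
  le_antisymm (isMultigraded_t2Ideal.le_of_forall fun _ _ hf hd =>
    mem_pow_t2Ideal_of_mem_wordSpan h hf hd) (pow_t2Ideal_le h)

lemma span_prod_ofFn_eq_pow {R : Type} [Ring R] [Algebra F R] (V : Submodule F R) (m : ℕ) :
    Submodule.span F {x | ∃ g : Fin m → R, (∀ i, g i ∈ V) ∧ x = (List.ofFn g).prod} = V ^ m := by
  rw [Submodule.pow_eq_span_pow_set]
  congr 1
  ext x
  rw [Set.mem_pow]
  constructor
  · rintro ⟨g, hg, rfl⟩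
    exact ⟨fun i => ⟨g i, hg i⟩, rfl⟩
  · rintro ⟨g, rfl⟩
    exact ⟨fun i => g i, fun i => (g i).2, rfl⟩

end Magnum

/-- If `T(C) = T(A)^m` then `H(C; T_k; Y_l) = ∑_{j=1}^m binom(m,j) H(A; T_k; Y_l)^j
(∑ t_i + ∑ y_s - 1)^{j-1}`. -/
theorem doubleHilbert_of_tideal_pow
    (F : Type) [Field F] [CharZero F]
    (A C : Type) [Ring A] [Algebra F A] [Ring C] [Algebra F C]
    (hPIA : polyIdeal F A ℕ ≠ ⊥) (hPIC : polyIdeal F C ℕ ≠ ⊥)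
    (m : ℕ) (hm : 1 ≤ m)
    (hT : polyIdeal F C ℕ = Submodule.span F
      {x | ∃ g : Fin m → FreeAlgebra F ℕ,
        (∀ i, g i ∈ polyIdeal F A ℕ) ∧ x = (List.ofFn g).prod})
    (k l : ℕ) :
    doubleHilbert F C k l =
      ∑ j ∈ Finset.Icc 1 m, (m.choose j : MvPowerSeries (Fin k ⊕ Fin l) ℚ) *
        doubleHilbert F A k l ^ j *
        (∑ i : Fin k, MvPowerSeries.X (Sum.inl i) + ∑ s : Fin l, MvPowerSeries.X (Sum.inr s)
          - 1) ^ (j - 1) := by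
  have h : t2Ideal F C k l = t2Ideal F A k l ^ m :=
    t2Ideal_eq_pow (hT.trans (span_prod_ofFn_eq_pow _ m))
  have hr : ∀ f ∈ t2Ideal F A k l, ∀ g, f * g ∈ t2Ideal F A k l := fun f hf g φ h0 h1 => by
    rw [map_mul, hf φ h0 h1, zero_mul]
  have hl : ∀ f, ∀ g ∈ t2Ideal F A k l, f * g ∈ t2Ideal F A k l := fun f g hg φ h0 h1 => by
    rw [map_mul, hg φ h0 h1, mul_zero]
  rw [doubleHilbert, h, FreeAlgebra.gradedSeries_pow isMultigraded_t2Ideal hr hl hm,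
    Fintype.sum_sum_type]
  rfl
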